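/- arXiv:2008.02418 — 11 statements merged into one kernel-verified Lean document; each statement's English description precedes it below -/
import Mathlib

section
/- For each link e, the Fenchel conjugate of the Beckmann link potential equals the stated closed form: for every t ≥ t̄_e, sup_{f ≥ 0} { t·f − σ_e(f) } = f̄_e · ((t − t̄_e)/(t̄_e ρ))^μ · (t − t̄_e)/(1 + μ). -/
open intervalIntegral in
/-- Closed form of the integral of the BPR cost `a * (1 + ρ * (z / b) ^ r)` over `[0, f]`. -/
theorem integral_bpr_cost {b r : ℝ} (hb : b ≠ 0) (hr : 0 ≤ r) (a ρ f : ℝ) :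
    ∫ z in (0:ℝ)..f, a * (1 + ρ * (z / b) ^ r)
      = a * (f + ρ * (b * ((f / b) ^ (r + 1) / (r + 1)))) := by
  have hcont : Continuous fun z : ℝ => (z / b) ^ r :=
    (continuous_id.div_const b).rpow_const fun _ => Or.inr hr
  have hpow : ∫ z in (0:ℝ)..f, (z / b) ^ r = b * ((f / b) ^ (r + 1) / (r + 1)) := by
    rw [integral_comp_div (fun z : ℝ => z ^ r) hb, integral_rpow (Or.inl (by linarith)), zero_div,
      Real.zero_rpow (by linarith), sub_zero, smul_eq_mul]
  rw [integral_const_mul, integral_add (by simp) ((hcont.const_mul ρ).intervalIntegrable _ _),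
    integral_const_mul, hpow]
  simp

/-- The Fenchel conjugate of `x ↦ x ^ (1 / μ + 1) / (1 / μ + 1)` on the half-line `0 ≤ x`:
the supremum is attained at `x = u ^ μ`. -/
theorem isGreatest_mul_sub_rpow_div {μ u : ℝ} (hμ : 0 < μ) (hu : 0 ≤ u) :
    IsGreatest {y : ℝ | ∃ x : ℝ, 0 ≤ x ∧ y = u * x - x ^ (1 / μ + 1) / (1 / μ + 1)}
      (u ^ μ * u / (1 + μ)) := by
  have hmul : u ^ μ * u = u ^ (1 + μ) := by
    rw [add_comm, Real.rpow_add_of_nonneg hu hμ.le zero_le_one, Real.rpow_one]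
  refine ⟨⟨u ^ μ, Real.rpow_nonneg hu μ, ?_⟩, ?_⟩
  · have hexp : μ * (1 / μ + 1) = 1 + μ := by field_simp
    rw [← Real.rpow_mul hu, hexp, mul_comm u, hmul]
    field_simp
    ring
  · rintro y ⟨x, hx, rfl⟩
    have hpq : (1 / μ + 1).HolderConjugate (1 + μ) := by
      rw [Real.holderConjugate_iff]
      refine ⟨by have := one_div_pos.2 hμ; linarith, ?_⟩
      field_simp
      ring
    have := Real.young_inequality_of_nonneg hx hu hpq
    rw [hmul]
    linarith


/-- Fenchel conjugate of the Beckmann link potential: for every `t ≥ t̄_e`,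
`sup_{f ≥ 0} { t·f − σ_e(f) } = f̄_e · ((t − t̄_e)/(t̄_e ρ))^μ · (t − t̄_e)/(1 + μ)`. -/
theorem beckmann_link_conjugate
    (tbar fbar ρ μ : ℝ) (htbar : 0 < tbar) (hfbar : 0 < fbar) (hρ : 0 < ρ)
    (hμ0 : 0 < μ) (hμ1 : μ ≤ 1)
    (τ : ℝ → ℝ) (hτ : ∀ f : ℝ, 0 ≤ f → τ f = tbar * (1 + ρ * (f / fbar) ^ (1 / μ)))
    (σ : ℝ → ℝ) (hσ : ∀ f : ℝ, σ f = ∫ z in (0:ℝ)..f, τ z)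
    (t : ℝ) (ht : tbar ≤ t) :
    IsLUB {y : ℝ | ∃ f : ℝ, 0 ≤ f ∧ y = t * f - σ f}
      (fbar * ((t - tbar) / (tbar * ρ)) ^ μ * (t - tbar) / (1 + μ)) := by
  have hu : 0 ≤ (t - tbar) / (tbar * ρ) := div_nonneg (sub_nonneg.2 ht) (by positivity)
  have hobj : ∀ f : ℝ, 0 ≤ f → t * f - σ f = tbar * ρ * fbar *
      ((t - tbar) / (tbar * ρ) * (f / fbar) - (f / fbar) ^ (1 / μ + 1) / (1 / μ + 1)) := by
    intro f hf
    have hσf : σ f = ∫ z in (0:ℝ)..f, tbar * (1 + ρ * (z / fbar) ^ (1 / μ)) := by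
      rw [hσ]
      refine intervalIntegral.integral_congr fun z hz => hτ z ?_
      rw [Set.uIcc_of_le hf] at hz
      exact hz.1
    have hlin : tbar * ρ * fbar * ((t - tbar) / (tbar * ρ) * (f / fbar)) = (t - tbar) * f := by
      field_simp
    rw [hσf, integral_bpr_cost hfbar.ne' (by positivity), mul_sub, hlin]
    ring
  have hval : fbar * ((t - tbar) / (tbar * ρ)) ^ μ * (t - tbar) / (1 + μ) = tbar * ρ * fbar *
      (((t - tbar) / (tbar * ρ)) ^ μ * ((t - tbar) / (tbar * ρ)) / (1 + μ)) := by
    generalize ((t - tbar) / (tbar * ρ)) ^ μ = w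
    field_simp
  obtain ⟨⟨x, hx, hmax⟩, hub⟩ := isGreatest_mul_sub_rpow_div hμ0 hu
  rw [hval]
  refine IsGreatest.isLUB ⟨⟨fbar * x, by positivity, ?_⟩, ?_⟩
  · rw [hobj _ (by positivity), mul_div_cancel_left₀ x hfbar.ne', hmax]
  · rintro y ⟨f, hf, rfl⟩
    rw [hobj f hf]
    exact mul_le_mul_of_nonneg_left (hub ⟨f / fbar, by positivity, rfl⟩) (by positivity)
end

section
/- Strong duality for the Beckmann model: min over feasible flows of the Beckmann potential equals minus the minimum of the dual objective, i.e. min_{x ∈ X} Ψ(Θx) = − min_{t ≥ t̄ coordinatewise} Q(t), where Q(t) = Φ(t) + ∑_e σ_e*(t_e) with σ_e*(t_e) = f̄_e ((t_e − t̄_e)/(t̄_e ρ))^μ (t_e − t̄_e)/(1+μ). -/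
open Finset

/-- The BPR link cost as a function of the flow. -/
noncomputable def bprCost (b c ρ μ z : ℝ) : ℝ := b * (1 + ρ * (z / c) ^ (1 / μ))

lemma continuous_bprCost (b c ρ : ℝ) {μ : ℝ} (hμ : 0 < μ) : Continuous (bprCost b c ρ μ) := by
  unfold bprCost
  have h : (0 : ℝ) ≤ 1 / μ := by positivity
  exact continuous_const.mul (continuous_const.add (continuous_const.mul
    ((continuous_id.div_const c).rpow_const fun _ => Or.inr h)))

lemma hasDerivAt_integral_bprCost (b c ρ : ℝ) {μ : ℝ} (hμ : 0 < μ) (x : ℝ) :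
    HasDerivAt (fun u => ∫ z in (0 : ℝ)..u, bprCost b c ρ μ z) (bprCost b c ρ μ x) x :=
  (continuous_bprCost b c ρ hμ).integral_hasStrictDerivAt 0 x |>.hasDerivAt

lemma bprCost_mono {b c ρ μ : ℝ} (hb : 0 < b) (hc : 0 < c) (hρ : 0 < ρ) (hμ : 0 < μ)
    {x y : ℝ} (hx : 0 ≤ x) (hxy : x ≤ y) : bprCost b c ρ μ x ≤ bprCost b c ρ μ y := by
  unfold bprCost
  gcongr

lemma le_bprCost {b c ρ μ : ℝ} (hb : 0 < b) (hc : 0 < c) (hρ : 0 < ρ) {x : ℝ} (hx : 0 ≤ x) :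
    b ≤ bprCost b c ρ μ x := by
  unfold bprCost
  have h : 0 ≤ b * (ρ * (x / c) ^ (1 / μ)) := by positivity
  linarith

lemma integral_bprCost {b c ρ μ : ℝ} (hc : 0 < c) (hμ : 0 < μ) {x : ℝ} (hx : 0 ≤ x) :
    ∫ z in (0 : ℝ)..x, bprCost b c ρ μ z
      = b * x + b * ρ * x * (x / c) ^ (1 / μ) * (μ / (1 + μ)) := by
  have h : (0 : ℝ) < 1 / μ := by positivity
  have hpow : ∀ u : ℝ, 0 ≤ u → u ^ (1 / μ + 1) = u ^ (1 / μ) * u := fun u hu => by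
    rw [Real.rpow_add_of_nonneg hu h.le zero_le_one, Real.rpow_one]
  have hcont : Continuous fun z : ℝ => (z / c) ^ (1 / μ) :=
    (continuous_id.div_const c).rpow_const fun _ => Or.inr h.le
  have hint : ∫ z in (0 : ℝ)..x, (z / c) ^ (1 / μ) = x * (x / c) ^ (1 / μ) * (μ / (1 + μ)) := by
    rw [intervalIntegral.integral_comp_div (fun u : ℝ => u ^ (1 / μ)) hc.ne',
      integral_rpow (Or.inl (by linarith)), zero_div, Real.zero_rpow (by positivity),
      hpow _ (by positivity), smul_eq_mul]
    field_simp
    ring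
  unfold bprCost
  rw [intervalIntegral.integral_const_mul, intervalIntegral.integral_add
    (continuous_const.intervalIntegrable _ _)
    (hcont.intervalIntegrable _ _ |>.const_mul ρ),
    intervalIntegral.integral_const_mul, hint, intervalIntegral.integral_const]
  simp only [sub_zero, smul_eq_mul]
  ring

/-- The equality case of the Fenchel–Young inequality for the BPR cost. -/
lemma integral_bprCost_eq_sub {b c ρ μ : ℝ} (hb : 0 < b) (hc : 0 < c) (hρ : 0 < ρ) (hμ : 0 < μ)
    {x : ℝ} (hx : 0 ≤ x) :
    ∫ z in (0 : ℝ)..x, bprCost b c ρ μ z = bprCost b c ρ μ x * x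
      - c * ((bprCost b c ρ μ x - b) / (b * ρ)) ^ μ * (bprCost b c ρ μ x - b) / (1 + μ) := by
  have hq : (bprCost b c ρ μ x - b) / (b * ρ) = (x / c) ^ (1 / μ) := by
    unfold bprCost
    field_simp
    ring
  rw [integral_bprCost hc hμ hx, hq, ← Real.rpow_mul (by positivity), one_div_mul_cancel hμ.ne',
    Real.rpow_one, bprCost]
  field_simp
  ring

lemma mul_sub_le_integral_bprCost {b c ρ μ : ℝ} (hb : 0 < b) (hc : 0 < c) (hρ : 0 < ρ)
    (hμ : 0 < μ) {x g : ℝ} (hx : 0 ≤ x) (hg : 0 ≤ g) :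
    bprCost b c ρ μ g * (x - g) ≤ (∫ z in (0 : ℝ)..x, bprCost b c ρ μ z)
      - ∫ z in (0 : ℝ)..g, bprCost b c ρ μ z := by
  have hi : ∀ u v, IntervalIntegrable (bprCost b c ρ μ) MeasureTheory.volume u v :=
    fun u v => (continuous_bprCost b c ρ hμ).intervalIntegrable u v
  rw [intervalIntegral.integral_interval_sub_left (hi _ _) (hi _ _)]
  rcases le_total g x with h | h
  · have := intervalIntegral.integral_mono_on h
      (intervalIntegrable_const (c := bprCost b c ρ μ g)) (hi g x)
      fun z hz => bprCost_mono hb hc hρ hμ hg hz.1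
    rw [intervalIntegral.integral_const, smul_eq_mul] at this
    linarith
  · have := intervalIntegral.integral_mono_on h (hi x g)
      (intervalIntegrable_const (c := bprCost b c ρ μ g))
      fun z hz => bprCost_mono hb hc hρ hμ (hx.trans hz.1) hz.2
    rw [intervalIntegral.integral_const, smul_eq_mul] at this
    rw [intervalIntegral.integral_symm]
    linarith

/-- The Fenchel–Young inequality for the BPR cost. -/
lemma mul_le_integral_bprCost_add {b c ρ μ : ℝ} (hb : 0 < b) (hc : 0 < c) (hρ : 0 < ρ)
    (hμ : 0 < μ) {x t : ℝ} (hx : 0 ≤ x) (ht : b ≤ t) :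
    t * x ≤ (∫ z in (0 : ℝ)..x, bprCost b c ρ μ z)
      + c * ((t - b) / (b * ρ)) ^ μ * (t - b) / (1 + μ) := by
  have hr : 0 ≤ (t - b) / (b * ρ) := div_nonneg (by linarith) (by positivity)
  have hg : 0 ≤ c * ((t - b) / (b * ρ)) ^ μ := by positivity
  have hcost : bprCost b c ρ μ (c * ((t - b) / (b * ρ)) ^ μ) = t := by
    rw [bprCost, mul_div_cancel_left₀ _ hc.ne', ← Real.rpow_mul hr, mul_one_div_cancel hμ.ne',
      Real.rpow_one]
    field_simp
    ring
  have h1 := mul_sub_le_integral_bprCost hb hc hρ hμ hx hg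
  have h2 := integral_bprCost_eq_sub hb hc hρ hμ hg
  rw [hcost] at h1 h2
  linarith

/-- If `h` is minimal at the left end of a unit interval, its derivative there is nonnegative. -/
lemma deriv_nonneg_of_forall_le {h : ℝ → ℝ} {h' : ℝ} (hd : HasDerivAt h h' 0)
    (hmin : ∀ s, 0 ≤ s → s ≤ 1 → h 0 ≤ h s) : 0 ≤ h' := by
  refine ge_of_tendsto hd.tendsto_slope_zero_right ?_
  filter_upwards [Ioo_mem_nhdsGT (zero_lt_one' ℝ)] with s hs
  have := hmin s hs.1.le hs.2.le
  rw [zero_add, smul_eq_mul]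
  exact mul_nonneg (inv_nonneg.2 hs.1.le) (by linarith)

section Assignment

variable {P W : Type} [Fintype P] [DecidableEq W] (wOD : P → W) (d : W → ℝ)

/-- The set of feasible path flows. -/
def feasibleFlows : Set (P → ℝ) :=
  {x | (∀ p, 0 ≤ x p) ∧ ∀ w, ∑ p ∈ univ.filter (fun p => wOD p = w), x p = d w}

lemma isCompact_feasibleFlows : IsCompact (feasibleFlows wOD d) := by
  refine (isCompact_Icc (a := (0 : P → ℝ)) (b := fun p => d (wOD p))).of_isClosed_subset ?_ ?_
  · have h : feasibleFlows wOD d = (⋂ p, {x | 0 ≤ x p}) ∩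
        ⋂ w, {x | ∑ p ∈ univ.filter (fun p => wOD p = w), x p = d w} := by
      ext x
      simp [feasibleFlows]
    rw [h]
    exact (isClosed_iInter fun p => isClosed_le continuous_const (continuous_apply p)).inter
      (isClosed_iInter fun w => isClosed_eq
        (continuous_finsetSum _ fun p _ => continuous_apply p) continuous_const)
  · rintro x ⟨h0, hs⟩
    refine ⟨h0, fun p => ?_⟩
    simp only [← hs (wOD p)]
    exact single_le_sum (f := x) (fun q _ => h0 q) (by simp)

lemma convex_feasibleFlows : Convex ℝ (feasibleFlows wOD d) := by
  rintro x ⟨hx0, hxs⟩ y ⟨hy0, hys⟩ u v hu hv huv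
  refine ⟨fun p => ?_, fun w => ?_⟩
  · have := hx0 p
    have := hy0 p
    simp only [Pi.add_apply, Pi.smul_apply, smul_eq_mul]
    positivity
  · simp only [Pi.add_apply, Pi.smul_apply, smul_eq_mul]
    rw [sum_add_distrib, ← mul_sum, ← mul_sum, hxs, hys, ← add_mul, huv, one_mul]

variable [Fintype W] {wOD d}

lemma sum_mul_inf'_le (hne : ∀ w : W, (univ.filter (fun p => wOD p = w)).Nonempty)
    {x : P → ℝ} (hx : x ∈ feasibleFlows wOD d) (T : P → ℝ) :
    ∑ w, d w * (univ.filter (fun p => wOD p = w)).inf' (hne w) T ≤ ∑ p, T p * x p := by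
  rw [← sum_fiberwise univ wOD]
  refine sum_le_sum fun w _ => ?_
  rw [← hx.2 w, sum_mul]
  refine sum_le_sum fun p hp => ?_
  rw [mul_comm]
  exact mul_le_mul_of_nonneg_right (inf'_le _ hp) (hx.1 p)

/-- The all-or-nothing assignment: all demand on a cheapest path. -/
lemma exists_feasibleFlows_sum_eq (hd : ∀ w, 0 ≤ d w)
    (hne : ∀ w : W, (univ.filter (fun p => wOD p = w)).Nonempty) (T : P → ℝ) :
    ∃ x ∈ feasibleFlows wOD d, ∑ p, T p * x p =
      ∑ w, d w * (univ.filter (fun p => wOD p = w)).inf' (hne w) T := by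
  classical
  choose q hq hqT using fun w => exists_mem_eq_inf' (hne w) T
  refine ⟨fun p => if p = q (wOD p) then d (wOD p) else 0, ⟨fun p => ?_, fun w => ?_⟩, ?_⟩
  · dsimp only
    split_ifs
    exacts [hd _, le_rfl]
  · rw [sum_eq_single_of_mem (q w) (hq w)]
    · rw [(mem_filter.1 (hq w)).2, if_pos rfl]
    · intro p hp hpq
      rw [(mem_filter.1 hp).2, if_neg hpq]
  · rw [← sum_fiberwise univ wOD]
    refine sum_congr rfl fun w _ => ?_
    rw [sum_eq_single_of_mem (q w) (hq w)]
    · dsimp only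
      rw [(mem_filter.1 (hq w)).2, if_pos rfl, hqT, mul_comm]
    · intro p hp hpq
      dsimp only
      rw [(mem_filter.1 hp).2, if_neg hpq, mul_zero]

end Assignment

/-- Strong duality for the Beckmann model:
`min_{x ∈ X} Ψ(Θx) = − min_{t ≥ t̄} Q(t)`, where
`Q(t) = Φ(t) + ∑_e σ_e*(t_e)`. -/
theorem beckmann_strong_duality
    (E P W : Type) [Fintype E] [Fintype P] [Fintype W] [DecidableEq W]
    (a : P → E → ℝ) (ha : ∀ p e, a p e = 0 ∨ a p e = 1)
    (wOD : P → W) (d : W → ℝ) (hd : ∀ w, 0 < d w)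
    (hne : ∀ w : W, (univ.filter (fun p => wOD p = w)).Nonempty)
    (tbar fbar : E → ℝ) (htbar : ∀ e, 0 < tbar e) (hfbar : ∀ e, 0 < fbar e)
    (ρ μ : ℝ) (hρ : 0 < ρ) (hμ0 : 0 < μ) (hμ1 : μ ≤ 1)
    (σ : E → ℝ → ℝ)
    (hσ : ∀ e (x : ℝ), σ e x = ∫ z in (0:ℝ)..x, tbar e * (1 + ρ * (z / fbar e) ^ (1 / μ)))
    (Ψ : (E → ℝ) → ℝ) (hΨ : ∀ f : E → ℝ, Ψ f = ∑ e, σ e (f e))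
    (Φ : (E → ℝ) → ℝ)
    (hΦ : ∀ t : E → ℝ, Φ t = -∑ w, d w *
        (univ.filter (fun p => wOD p = w)).inf' (hne w) (fun p => ∑ e, t e * a p e))
    (σs : E → ℝ → ℝ)
    (hσs : ∀ e (te : ℝ), σs e te =
      fbar e * ((te - tbar e) / (tbar e * ρ)) ^ μ * (te - tbar e) / (1 + μ))
    (Q : (E → ℝ) → ℝ) (hQ : ∀ t : E → ℝ, Q t = Φ t + ∑ e, σs e (t e)) :
    sInf {y : ℝ | ∃ x : P → ℝ, (∀ p, 0 ≤ x p) ∧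
        (∀ w, ∑ p ∈ univ.filter (fun p => wOD p = w), x p = d w) ∧
        y = Ψ (fun e => ∑ p, a p e * x p)}
      = - sInf {y : ℝ | ∃ t : E → ℝ, (∀ e, tbar e ≤ t e) ∧ y = Q t} := by
  obtain rfl : σ = fun e x => ∫ z in (0 : ℝ)..x, bprCost (tbar e) (fbar e) ρ μ z := by
    funext e x
    exact hσ e x
  set X := feasibleFlows wOD d
  let F : (P → ℝ) → E → ℝ := fun x e => ∑ p, a p e * x p
  have hF0 : ∀ x ∈ X, ∀ e, 0 ≤ F x e := fun x hx e => sum_nonneg fun p _ =>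
    mul_nonneg (by rcases ha p e with h | h <;> simp [h]) (hx.1 p)
  have hcost : ∀ (t : E → ℝ) (x : P → ℝ),
      ∑ p, (∑ e, t e * a p e) * x p = ∑ e, t e * F x e := by
    intro t x
    simp only [F, sum_mul, mul_sum]
    rw [sum_comm]
    exact sum_congr rfl fun e _ => sum_congr rfl fun p _ => by ring
  have hweak : ∀ x ∈ X, ∀ t : E → ℝ, (∀ e, tbar e ≤ t e) → -Q t ≤ Ψ (F x) := by
    intro x hx t ht
    have h1 := sum_mul_inf'_le hne hx (fun p => ∑ e, t e * a p e)
    rw [hcost] at h1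
    have h2 : ∑ e, t e * F x e ≤ Ψ (F x) + ∑ e, σs e (t e) := by
      rw [hΨ, ← sum_add_distrib]
      refine sum_le_sum fun e _ => ?_
      rw [hσs]
      exact mul_le_integral_bprCost_add (htbar e) (hfbar e) hρ hμ0 (hF0 x hx e) (ht e)
    rw [hQ, hΦ]
    linarith
  have hFc : Continuous F := by
    refine continuous_pi fun e => continuous_finsetSum _ fun p _ => ?_
    exact continuous_const.mul (continuous_apply p)
  have hΨc : Continuous Ψ := by
    rw [funext hΨ]
    refine continuous_finsetSum _ fun e _ => ?_
    exact (continuous_iff_continuousAt.2 fun u =>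
      (hasDerivAt_integral_bprCost (tbar e) (fbar e) ρ hμ0 u).continuousAt).comp
      (continuous_apply e)
  have hXne : X.Nonempty := by
    obtain ⟨x, hx, -⟩ := exists_feasibleFlows_sum_eq (fun w => (hd w).le) hne 0
    exact ⟨x, hx⟩
  obtain ⟨x, hx, hmin⟩ := (isCompact_feasibleFlows wOD d).exists_isMinOn hXne
    (hΨc.comp hFc).continuousOn
  let t : E → ℝ := fun e => bprCost (tbar e) (fbar e) ρ μ (F x e)
  have hvar : ∀ y ∈ X, 0 ≤ ∑ e, t e * (F y e - F x e) := by
    intro y hy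
    refine deriv_nonneg_of_forall_le
      (h := fun s => Ψ (fun e => F x e + s * (F y e - F x e))) ?_ ?_
    · simp only [hΨ]
      refine HasDerivAt.fun_sum fun e _ => ?_
      have hlin : HasDerivAt (fun s : ℝ => F x e + s * (F y e - F x e)) (F y e - F x e) 0 := by
        simpa using ((hasDerivAt_id (0 : ℝ)).mul_const (F y e - F x e)).const_add (F x e)
      have hσd := hasDerivAt_integral_bprCost (tbar e) (fbar e) ρ hμ0 (F x e)
      exact HasDerivAt.comp_of_eq 0 hσd hlin (by simp)
    · intro s h0 h1
      have hmem := convex_feasibleFlows wOD d hx hy (sub_nonneg.2 h1) h0 (by ring)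
      have hseg : (fun e => F x e + s * (F y e - F x e)) = F ((1 - s) • x + s • y) := by
        funext e
        simp only [F, Pi.add_apply, Pi.smul_apply, smul_eq_mul, mul_sum, ← sum_sub_distrib,
          ← sum_add_distrib]
        exact sum_congr rfl fun p _ => by ring
      simp only [hseg, zero_mul, add_zero]
      exact hmin hmem
  have ht : ∀ e, tbar e ≤ t e := fun e => le_bprCost (htbar e) (hfbar e) hρ (hF0 x hx e)
  have hstrong : Ψ (F x) ≤ -Q t := by
    obtain ⟨y, hy, hyT⟩ := exists_feasibleFlows_sum_eq (fun w => (hd w).le) hne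
      (fun p => ∑ e, t e * a p e)
    rw [hcost] at hyT
    have h1 := hvar y hy
    simp only [mul_sub, sum_sub_distrib] at h1
    have h2 : Ψ (F x) = ∑ e, t e * F x e - ∑ e, σs e (t e) := by
      rw [hΨ, ← sum_sub_distrib]
      refine sum_congr rfl fun e _ => ?_
      rw [hσs]
      exact integral_bprCost_eq_sub (htbar e) (hfbar e) hρ hμ0 (hF0 x hx e)
    rw [hQ, hΦ]
    linarith
  have heq : Ψ (F x) = -Q t := hstrong.antisymm (hweak x hx t ht)
  have hprimal : IsLeast {y : ℝ | ∃ x : P → ℝ, (∀ p, 0 ≤ x p) ∧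
      (∀ w, ∑ p ∈ univ.filter (fun p => wOD p = w), x p = d w) ∧
      y = Ψ (fun e => ∑ p, a p e * x p)} (Ψ (F x)) := by
    refine ⟨⟨x, hx.1, hx.2, rfl⟩, ?_⟩
    rintro _ ⟨z, hz0, hzs, rfl⟩
    exact hmin (show z ∈ feasibleFlows wOD d from ⟨hz0, hzs⟩)
  have hdual : IsLeast {y : ℝ | ∃ t : E → ℝ, (∀ e, tbar e ≤ t e) ∧ y = Q t} (Q t) := by
    refine ⟨⟨t, ht, rfl⟩, ?_⟩
    rintro _ ⟨s, hs, rfl⟩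
    linarith [hweak x hx s hs]
  rw [hprimal.csInf_eq, hdual.csInf_eq, heq]
end

section
/- Subdifferential of the dual travel-time function: for every t ∈ ℝ^E, the subdifferential of the convex function Φ at t equals −∑_{w ∈ W} d_w · conv{ a_p : p ∈ P, w(p) = w, T_p(t) = T_w(t) } (Minkowski sum over w of scaled convex hulls of the indicator vectors of shortest paths). Equivalently, g is a subgradient of Φ at t if and only if g = −Θx for some x ∈ X with x_p > 0 ⟹ T_p(t) = T_{w(p)}(t). -/
open Finset

section FlowPolytope

variable {P W : Type*} [Fintype P] [DecidableEq W]

/-- The polytope of path flows that meet the demands `d`. -/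
def pathFlows (wOD : P → W) (d : W → ℝ) : Set (P → ℝ) :=
  {x | (∀ p, 0 ≤ x p) ∧ ∀ w, ∑ p ∈ univ.filter (fun p => wOD p = w), x p = d w}

variable {wOD : P → W} {d : W → ℝ}

theorem convex_pathFlows : Convex ℝ (pathFlows wOD d) := by
  rintro x ⟨hx0, hxd⟩ y ⟨hy0, hyd⟩ α β hα hβ hαβ
  refine ⟨fun p => ?_, fun w => ?_⟩
  · have := mul_nonneg hα (hx0 p)
    have := mul_nonneg hβ (hy0 p)
    simp only [Pi.add_apply, Pi.smul_apply, smul_eq_mul]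
    positivity
  · simp only [Pi.add_apply, Pi.smul_apply, smul_eq_mul, sum_add_distrib, ← mul_sum, hxd, hyd]
    rw [← add_mul, hαβ, one_mul]

theorem isCompact_pathFlows : IsCompact (pathFlows wOD d) := by
  refine (isCompact_Icc (a := (0 : P → ℝ)) (b := fun p => d (wOD p))).of_isClosed_subset ?_ ?_
  · simp only [pathFlows, Set.ofPred_and, Set.ofPred_forall]
    exact (isClosed_iInter fun p => isClosed_le (by fun_prop) (by fun_prop)).inter
      (isClosed_iInter fun w => isClosed_eq (by fun_prop) (by fun_prop))
  · rintro x ⟨hx0, hxd⟩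
    refine ⟨hx0, fun p => ?_⟩
    dsimp only
    rw [← hxd (wOD p)]
    exact single_le_sum (f := x) (fun q _ => hx0 q) (by simp)

theorem sum_mul_eq_of_mem_pathFlows [Fintype W] {x : P → ℝ} (hx : x ∈ pathFlows wOD d) (m : W → ℝ) :
    ∑ p, x p * m (wOD p) = ∑ w, d w * m w := by
  rw [← sum_fiberwise univ wOD]
  refine sum_congr rfl fun w _ => ?_
  rw [← hx.2 w, sum_mul]
  exact sum_congr rfl fun p hp => by rw [(mem_filter.1 hp).2]

/-- Sending each demand along a cheapest path gives a flow of minimal total cost. -/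
theorem exists_pathFlow_sum_mul_eq [Fintype W] (hd : ∀ w, 0 ≤ d w)
    (hne : ∀ w : W, (univ.filter (fun p => wOD p = w)).Nonempty) (c : P → ℝ) :
    ∃ x ∈ pathFlows wOD d,
      ∑ p, x p * c p =
        ∑ w, d w * (univ.filter (fun p => wOD p = w)).inf' (hne w) c := by
  classical
  choose q hq hqc using fun w => exists_mem_eq_inf' (hne w) c
  have hqw : ∀ w, wOD (q w) = w := fun w => (mem_filter.1 (hq w)).2
  have hx : (fun p => if p = q (wOD p) then d (wOD p) else 0) ∈ pathFlows wOD d := by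
    refine ⟨fun p => ?_, fun w => ?_⟩
    · dsimp only
      split_ifs
      exacts [hd _, le_rfl]
    · rw [sum_eq_single_of_mem (q w) (hq w)]
      · simp [hqw]
      · intro p hp hpq
        rw [(mem_filter.1 hp).2, if_neg hpq]
  refine ⟨_, hx, ?_⟩
  rw [← sum_mul_eq_of_mem_pathFlows hx]
  refine sum_congr rfl fun p _ => ?_
  split_ifs with h
  · rw [hqc, ← h]
  · simp

variable {E : Type*} [Fintype E]

theorem sum_mul_neg_sum (a : P → E → ℝ) (x : P → ℝ) (s : E → ℝ) :
    ∑ e, s e * -(∑ p, a p e * x p) = -∑ p, x p * ∑ e, s e * a p e := by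
  simp only [mul_neg, sum_neg_distrib, mul_sum]
  rw [sum_comm]
  simp only [mul_comm, mul_left_comm]

/-- If a linear functional minus a constant is bounded above by the support function of the image
of the flow polytope under `x ↦ -Θx`, then it is represented by a point of that image. -/
theorem exists_pathFlow_of_forall_exists_le (a : P → E → ℝ) (g : E → ℝ) (K : ℝ)
    (h : ∀ s : E → ℝ, ∃ x ∈ pathFlows wOD d,
      K + ∑ e, s e * g e ≤ ∑ e, s e * -(∑ p, a p e * x p)) :
    ∃ x ∈ pathFlows wOD d, ∀ e, g e = -(∑ p, a p e * x p) := by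
  classical
  let L : (P → ℝ) →ₗ[ℝ] (E → ℝ) := -(Matrix.of fun e p => a p e).mulVecLin
  have hL : ∀ x e, L x e = -(∑ p, a p e * x p) := fun x e => by
    simp [L, Matrix.mulVec, dotProduct]
  have hclosed : IsClosed (L '' pathFlows wOD d) :=
    (isCompact_pathFlows.image L.continuous_of_finiteDimensional).isClosed
  suffices hg : g ∈ L '' pathFlows wOD d by
    obtain ⟨x, hx, rfl⟩ := hg
    exact ⟨x, hx, hL x⟩
  by_contra hg
  obtain ⟨f, u, hfu, huf⟩ := geometric_hahn_banach_closed_point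
    (convex_pathFlows.linear_image L) hclosed hg
  have hf : ∀ (r : ℝ) (y : E → ℝ),
      ∑ e, (r * f (Pi.single e 1)) * y e = r * f y := fun r y => by
    have hy : f y = ∑ e, y e * f (Pi.single e 1) := by
      conv_lhs => rw [pi_eq_sum_univ' y]
      simp
    rw [hy, mul_sum]
    exact sum_congr rfl fun e _ => by ring
  have hpos : 0 < f g - u := sub_pos.2 huf
  obtain ⟨n, hn⟩ := exists_nat_gt (-K / (f g - u))
  obtain ⟨x, hx, hle⟩ := h fun e => (n : ℝ) * f (Pi.single e 1)
  simp only [← hL, hf] at hle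
  have hub := mul_le_mul_of_nonneg_left (hfu _ (Set.mem_image_of_mem L hx)).le n.cast_nonneg
  rw [div_lt_iff₀ hpos] at hn
  linarith

end FlowPolytope

/-- Subdifferential of the dual travel-time function: `g` is a subgradient of
`Φ` at `t` if and only if `g = −Θx` for some `x ∈ X` supported on shortest
paths, i.e. `x_p > 0 ⟹ T_p(t) = T_{w(p)}(t)`. -/
theorem subdifferential_of_Phi
    (E P W : Type) [Fintype E] [Fintype P] [Fintype W] [DecidableEq W]
    (a : P → E → ℝ) (ha : ∀ p e, a p e = 0 ∨ a p e = 1)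
    (wOD : P → W) (d : W → ℝ) (hd : ∀ w, 0 < d w)
    (hne : ∀ w : W, (univ.filter (fun p => wOD p = w)).Nonempty)
    (T : W → (E → ℝ) → ℝ)
    (hT : ∀ w (t : E → ℝ), T w t =
      (univ.filter (fun p => wOD p = w)).inf' (hne w) (fun p => ∑ e, t e * a p e))
    (Φ : (E → ℝ) → ℝ) (hΦ : ∀ t : E → ℝ, Φ t = -∑ w, d w * T w t)
    (t g : E → ℝ) :
    (∀ s : E → ℝ, Φ t + ∑ e, g e * (s e - t e) ≤ Φ s) ↔
    (∃ x : P → ℝ, (∀ p, 0 ≤ x p) ∧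
      (∀ w, ∑ p ∈ univ.filter (fun p => wOD p = w), x p = d w) ∧
      (∀ p, 0 < x p → (∑ e, t e * a p e) = T (wOD p) t) ∧
      (∀ e, g e = -(∑ p, a p e * x p))) := by
  have hle : ∀ (s : E → ℝ) (p : P), T (wOD p) s ≤ ∑ e, s e * a p e := fun s p => by
    rw [hT]
    exact inf'_le (fun p => ∑ e, s e * a p e) (by simp)
  constructor
  · intro h
    obtain ⟨x, hx, hg⟩ := exists_pathFlow_of_forall_exists_le (wOD := wOD) (d := d) a g
      (Φ t - ∑ e, t e * g e) fun s => by
        obtain ⟨x, hx, hxs⟩ := exists_pathFlow_sum_mul_eq (fun w => (hd w).le) hne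
          fun p => ∑ e, s e * a p e
        refine ⟨x, hx, ?_⟩
        have hs := h s
        simp only [hΦ s, hT _ s] at hs
        rw [sum_mul_neg_sum, hxs]
        simp only [mul_sub, sum_sub_distrib] at hs
        simp only [mul_comm (g _)] at hs
        linarith
    refine ⟨x, hx.1, hx.2, fun p hp => ?_, hg⟩
    have h0 := h 0
    have hΦ0 : Φ 0 = 0 := by simp [hΦ, hT]
    have hgt : ∑ e, t e * g e = -∑ p, x p * ∑ e, t e * a p e := by
      rw [← sum_mul_neg_sum]
      exact sum_congr rfl fun e _ => by rw [hg]
    have hsum : ∑ p, x p * T (wOD p) t = ∑ p, x p * ∑ e, t e * a p e := by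
      refine le_antisymm
        (sum_le_sum fun p _ => mul_le_mul_of_nonneg_left (hle t p) (hx.1 p)) ?_
      rw [sum_mul_eq_of_mem_pathFlows hx fun w => T w t]
      simp only [hΦ0, hΦ t, Pi.zero_apply, zero_sub, mul_neg, sum_neg_distrib] at h0
      simp only [mul_comm (g _)] at h0
      linarith
    have hp' := (sum_eq_sum_iff_of_le
      fun p _ => mul_le_mul_of_nonneg_left (hle t p) (hx.1 p)).1 hsum p (mem_univ p)
    exact (mul_left_cancel₀ hp.ne' hp').symm
  · rintro ⟨x, hx0, hxd, hxt, hg⟩ s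
    have hx : x ∈ pathFlows wOD d := ⟨hx0, hxd⟩
    have hgs : ∀ r : E → ℝ, ∑ e, g e * r e = -∑ p, x p * ∑ e, r e * a p e := fun r => by
      rw [← sum_mul_neg_sum]
      exact sum_congr rfl fun e _ => by rw [hg, mul_comm]
    have ht : ∑ p, x p * ∑ e, t e * a p e = ∑ p, x p * T (wOD p) t :=
      sum_congr rfl fun p _ => by
        rcases (hx0 p).eq_or_lt with h | h
        · simp [← h]
        · rw [hxt p h]
    have hs : ∑ p, x p * T (wOD p) s ≤ ∑ p, x p * ∑ e, s e * a p e :=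
      sum_le_sum fun p _ => mul_le_mul_of_nonneg_left (hle s p) (hx0 p)
    simp only [mul_sub, sum_sub_distrib, hgs, hΦ]
    rw [← sum_mul_eq_of_mem_pathFlows hx fun w => T w t,
      ← sum_mul_eq_of_mem_pathFlows hx fun w => T w s]
    linarith
end

section
/- Uniform bound on subgradient differences: if every path contains at most H links (i.e. ∑_e (a_p)_e ≤ H for all p ∈ P), then for any t¹, t² ∈ ℝ₊^E and any subgradients g¹ of Φ at t¹ and g² of Φ at t², one has ‖g¹ − g²‖₂ ≤ √(2H) · ∑_{w ∈ W} d_w. -/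
open Finset

/-- A subgradient of the negated weighted sum of minimal path costs is controlled in every direction
along which the costs of all paths are uniformly bounded below. -/
lemma sum_subgradient_mul_le_neg
    {E P W : Type} [Fintype E] [Fintype P] [Fintype W] [DecidableEq W]
    {a : P → E → ℝ} {wOD : P → W} {d : W → ℝ} (hd : ∀ w, 0 < d w)
    {hne : ∀ w : W, (univ.filter (fun p => wOD p = w)).Nonempty}
    {Φ : (E → ℝ) → ℝ}
    (hΦ : ∀ t : E → ℝ, Φ t = -∑ w, d w *
        (univ.filter (fun p => wOD p = w)).inf' (hne w) (fun p => ∑ e, t e * a p e))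
    {t g : E → ℝ} (hg : ∀ s : E → ℝ, Φ t + ∑ e, g e * (s e - t e) ≤ Φ s)
    {u : E → ℝ} {c : ℝ} (hc : ∀ p, c ≤ ∑ e, u e * a p e) :
    ∑ e, g e * u e ≤ -(c * ∑ w, d w) := by
  have h := hg (t + u)
  have hT : ∑ w, d w * ((univ.filter (fun p => wOD p = w)).inf' (hne w)
        (fun p => ∑ e, t e * a p e) + c) ≤
      ∑ w, d w * (univ.filter (fun p => wOD p = w)).inf' (hne w)
        (fun p => ∑ e, (t + u) e * a p e) := by
    refine sum_le_sum fun w _ => mul_le_mul_of_nonneg_left (le_inf' _ _ fun p hp => ?_) (hd w).le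
    simp only [Pi.add_apply, add_mul, sum_add_distrib]
    exact add_le_add (inf'_le (fun p => ∑ e, t e * a p e) hp) (hc p)
  simp only [mul_add, sum_add_distrib, ← sum_mul] at hT
  rw [hΦ t, hΦ (t + u)] at h
  simp only [Pi.add_apply, add_sub_cancel_left] at h hT
  linarith

/-- The coordinates of a subgradient lie in `[-D, 0]`, where `D` is the total demand, and its
squared Euclidean norm is at most `H * D ^ 2`. -/
lemma subgradient_nonpos_and_sum_sq_le
    {E P W : Type} [Fintype E] [Fintype P] [Fintype W] [DecidableEq W]
    {a : P → E → ℝ} (ha : ∀ p e, a p e = 0 ∨ a p e = 1)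
    {wOD : P → W} {d : W → ℝ} (hd : ∀ w, 0 < d w)
    {hne : ∀ w : W, (univ.filter (fun p => wOD p = w)).Nonempty}
    {Φ : (E → ℝ) → ℝ}
    (hΦ : ∀ t : E → ℝ, Φ t = -∑ w, d w *
        (univ.filter (fun p => wOD p = w)).inf' (hne w) (fun p => ∑ e, t e * a p e))
    {H : ℕ} (hpath : ∀ p, ∑ e, a p e ≤ (H : ℝ))
    {t g : E → ℝ} (hg : ∀ s : E → ℝ, Φ t + ∑ e, g e * (s e - t e) ≤ Φ s) :
    (∀ e, g e ≤ 0) ∧ ∑ e, g e ^ 2 ≤ H * (∑ w, d w) ^ 2 := by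
  classical
  have hnonpos : ∀ e, g e ≤ 0 := fun i => by
    have h := sum_subgradient_mul_le_neg hd hΦ hg (u := Pi.single i 1) (c := 0) fun p => by
      rcases ha p i with h | h <;> simp [Pi.single_apply, h]
    simpa [Pi.single_apply] using h
  have hlower : ∀ e, -g e ≤ ∑ w, d w := fun i => by
    have h := sum_subgradient_mul_le_neg hd hΦ hg (u := Pi.single i (-1)) (c := -1) fun p => by
      rcases ha p i with h | h <;> simp [Pi.single_apply, h]
    simpa [Pi.single_apply] using h
  have hsum : -∑ e, g e ≤ H * ∑ w, d w := by
    have h := sum_subgradient_mul_le_neg hd hΦ hg (u := fun _ => -1) (c := -H) fun p => by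
      simpa using hpath p
    simpa using h
  refine ⟨hnonpos, ?_⟩
  calc ∑ e, g e ^ 2 ≤ ∑ e, -g e * ∑ w, d w :=
        sum_le_sum fun e _ => by nlinarith [hnonpos e, hlower e]
    _ = (-∑ e, g e) * ∑ w, d w := by rw [← sum_mul, sum_neg_distrib]
    _ ≤ (H * ∑ w, d w) * ∑ w, d w :=
        mul_le_mul_of_nonneg_right hsum (sum_nonneg fun w _ => (hd w).le)
    _ = H * (∑ w, d w) ^ 2 := by ring

/-- Uniform bound on subgradient differences: if every path contains at most
`H` links, then for any `t¹, t² ∈ ℝ₊^E` and any subgradients `g¹` of `Φ` at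
`t¹` and `g²` of `Φ` at `t²`, `‖g¹ − g²‖₂ ≤ √(2H) · ∑_w d_w`. -/
theorem subgradient_difference_bound
    (E P W : Type) [Fintype E] [Fintype P] [Fintype W] [DecidableEq W]
    (a : P → E → ℝ) (ha : ∀ p e, a p e = 0 ∨ a p e = 1)
    (wOD : P → W) (d : W → ℝ) (hd : ∀ w, 0 < d w)
    (hne : ∀ w : W, (univ.filter (fun p => wOD p = w)).Nonempty)
    (Φ : (E → ℝ) → ℝ)
    (hΦ : ∀ t : E → ℝ, Φ t = -∑ w, d w *
        (univ.filter (fun p => wOD p = w)).inf' (hne w) (fun p => ∑ e, t e * a p e))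
    (H : ℕ) (hH : 0 < H) (hpath : ∀ p, ∑ e, a p e ≤ (H : ℝ))
    (t1 t2 g1 g2 : E → ℝ)
    (ht1 : ∀ e, 0 ≤ t1 e) (ht2 : ∀ e, 0 ≤ t2 e)
    (hg1 : ∀ s : E → ℝ, Φ t1 + ∑ e, g1 e * (s e - t1 e) ≤ Φ s)
    (hg2 : ∀ s : E → ℝ, Φ t2 + ∑ e, g2 e * (s e - t2 e) ≤ Φ s) :
    Real.sqrt (∑ e, (g1 e - g2 e) ^ 2) ≤ Real.sqrt (2 * H) * ∑ w, d w := by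
  obtain ⟨hn1, hs1⟩ := subgradient_nonpos_and_sum_sq_le ha hd hΦ hpath hg1
  obtain ⟨hn2, hs2⟩ := subgradient_nonpos_and_sum_sq_le ha hd hΦ hpath hg2
  have hD : 0 ≤ ∑ w, d w := sum_nonneg fun w _ => (hd w).le
  have hsq : ∑ e, (g1 e - g2 e) ^ 2 ≤ ∑ e, g1 e ^ 2 + ∑ e, g2 e ^ 2 := by
    rw [← sum_add_distrib]
    exact sum_le_sum fun e _ => by nlinarith [mul_nonneg_of_nonpos_of_nonpos (hn1 e) (hn2 e)]
  refine Real.sqrt_le_iff.2 ⟨by positivity, ?_⟩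
  rw [mul_pow, Real.sq_sqrt (by positivity)]
  linarith
end

section
/- Lemma 3.1 (UGM for the stable dynamics model): assume points t^0, …, t^{N} ≥ t̄, constants L_1, …, L_N > 0, and subgradients g^k of Φ at t^k with −g^k = Θx^k for some x^k ∈ X (k = 0, …, N−1) satisfy the universal gradient inequality Q(t̂^N) ≤ min_{t ≥ t̄} { (1/S_N) ∑_{k=0}^{N−1} (1/L_{k+1}) [Φ(t^k) + ⟨g^k, t − t^k⟩] + ⟨t − t̄, f̄⟩ + ‖t − t̄‖₂²/S_N } + ε/2, where S_N = ∑_{k=1}^{N} 1/L_k, t̂^N = (1/S_N) ∑_{k=1}^{N} t^k/L_k and f̂^N = −(1/S_N) ∑_{k=0}^{N−1} g^k/L_{k+1}. Let t* minimize Q over {t ≥ t̄} and R = ‖t* − t̄‖₂. Then: (i) Q(t̂^N) − Q(t*) ≤ R²/S_N + ε/2; (ii) 0 ≤ Q(t̂^N) + Ψ(f̂^N) + ⟨t* − t̄, (f̂^N − f̄)₊⟩ ≤ R²/S_N + ε/2; and (iii) ‖(f̂^N − f̄)₊‖₂ ≤ 4R/S_N + √(2ε/S_N), where (v)₊ denotes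 the coordinatewise positive part. -/
open Finset

/-- A subgradient `g` at `t` of a function with `Φ 0 = 0` and `Φ (2 t) ≤ 2 Φ t` satisfies
`Φ t = ⟨g, t⟩`. -/
lemma eq_sum_mul_of_subgradient {E : Type*} [Fintype E] {Φ : (E → ℝ) → ℝ} {g t : E → ℝ}
    (h_zero : Φ 0 = 0) (h_two : Φ (fun e => 2 * t e) ≤ 2 * Φ t)
    (hg : ∀ s : E → ℝ, Φ t + ∑ e, g e * (s e - t e) ≤ Φ s) :
    Φ t = ∑ e, g e * t e := by
  apply le_antisymm
  · have h := hg 0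
    simp only [Pi.zero_apply, zero_sub, mul_neg, sum_neg_distrib, h_zero] at h
    linarith
  · have h := hg (fun e => 2 * t e)
    have hsum : ∑ e, g e * (2 * t e - t e) = ∑ e, g e * t e :=
      sum_congr rfl fun e _ => by ring
    linarith

lemma le_add_of_sq_sub_mul_le_sq {n y z : ℝ} (hy : 0 ≤ y) (hz : 0 ≤ z)
    (h : n ^ 2 - y * n ≤ z ^ 2) : n ≤ y + z := by
  by_contra! hn
  nlinarith [mul_nonneg hy hz, mul_pos (sub_pos.2 hn) (sub_pos.2 hn)]

lemma mul_inf'_le_inf'_mul {ι : Type*} {s : Finset ι} (hs : s.Nonempty) (f : ι → ℝ) {c : ℝ}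
    (hc : 0 ≤ c) : c * s.inf' hs f ≤ s.inf' hs fun i => c * f i :=
  le_inf' hs _ fun _ hi => mul_le_mul_of_nonneg_left (inf'_le f hi) hc

/-- Lemma 3.1 (UGM for the stable dynamics model): under the universal gradient
inequality, with `S_N = ∑_{k=1}^N 1/L_k`, `t̂^N = (1/S_N) ∑_{k=1}^N t^k/L_k`,
`f̂^N = −(1/S_N) ∑_{k=0}^{N−1} g^k/L_{k+1}`, a minimizer `t*` of `Q` over
`{t ≥ t̄}` and `R = ‖t* − t̄‖₂`, one has
(i) `Q(t̂^N) − Q(t*) ≤ R²/S_N + ε/2`;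
(ii) `0 ≤ Q(t̂^N) + Ψ(f̂^N) + ⟨t* − t̄, (f̂^N − f̄)₊⟩ ≤ R²/S_N + ε/2`;
(iii) `‖(f̂^N − f̄)₊‖₂ ≤ 4R/S_N + √(2ε/S_N)`. -/
theorem ugm_stable_dynamics_lemma
    (E P W : Type) [Fintype E] [Fintype P] [Fintype W] [DecidableEq W]
    (a : P → E → ℝ) (ha : ∀ p e, a p e = 0 ∨ a p e = 1)
    (wOD : P → W) (d : W → ℝ) (hd : ∀ w, 0 < d w)
    (hne : ∀ w : W, (univ.filter (fun p => wOD p = w)).Nonempty)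
    (Φ : (E → ℝ) → ℝ)
    (hΦ : ∀ t : E → ℝ, Φ t = -∑ w, d w *
        (univ.filter (fun p => wOD p = w)).inf' (hne w) (fun p => ∑ e, t e * a p e))
    (tbar fbar : E → ℝ) (htbar : ∀ e, 0 < tbar e) (hfbar : ∀ e, 0 < fbar e)
    (Ψ : (E → ℝ) → ℝ) (hΨ : ∀ f : E → ℝ, Ψ f = ∑ e, tbar e * f e)
    (Q : (E → ℝ) → ℝ) (hQ : ∀ t : E → ℝ, Q t = Φ t + ∑ e, (t e - tbar e) * fbar e)
    (ε : ℝ) (hε : 0 < ε)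
    (N : ℕ) (hN : 0 < N)
    (tv : ℕ → E → ℝ) (htv : ∀ k, k ≤ N → ∀ e, tbar e ≤ tv k e)
    (L : ℕ → ℝ) (hL : ∀ k, 1 ≤ k → k ≤ N → 0 < L k)
    (gv : ℕ → E → ℝ)
    (hgsub : ∀ k, k < N → ∀ s : E → ℝ, Φ (tv k) + ∑ e, gv k e * (s e - tv k e) ≤ Φ s)
    (xv : ℕ → P → ℝ)
    (hxv0 : ∀ k, k < N → ∀ p, 0 ≤ xv k p)
    (hxvd : ∀ k, k < N → ∀ w, ∑ p ∈ univ.filter (fun p => wOD p = w), xv k p = d w)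
    (hgx : ∀ k, k < N → ∀ e, gv k e = -(∑ p, a p e * xv k p))
    (S : ℝ) (hS : S = ∑ k ∈ range N, 1 / L (k + 1))
    (that : E → ℝ)
    (hthat : ∀ e, that e = (1 / S) * ∑ k ∈ range N, tv (k + 1) e / L (k + 1))
    (fhat : E → ℝ)
    (hfhat : ∀ e, fhat e = -((1 / S) * ∑ k ∈ range N, gv k e / L (k + 1)))
    (hUGI : ∀ t : E → ℝ, (∀ e, tbar e ≤ t e) →
      Q that ≤ (1 / S) * ∑ k ∈ range N, (1 / L (k + 1)) *
          (Φ (tv k) + ∑ e, gv k e * (t e - tv k e))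
        + ∑ e, (t e - tbar e) * fbar e + (∑ e, (t e - tbar e) ^ 2) / S + ε / 2)
    (tstar : E → ℝ) (htstar : ∀ e, tbar e ≤ tstar e)
    (htstar_min : ∀ t : E → ℝ, (∀ e, tbar e ≤ t e) → Q tstar ≤ Q t)
    (R : ℝ) (hR : R = Real.sqrt (∑ e, (tstar e - tbar e) ^ 2)) :
    (Q that - Q tstar ≤ R ^ 2 / S + ε / 2) ∧
    (0 ≤ Q that + Ψ fhat + ∑ e, (tstar e - tbar e) * max (fhat e - fbar e) 0 ∧
      Q that + Ψ fhat + ∑ e, (tstar e - tbar e) * max (fhat e - fbar e) 0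
        ≤ R ^ 2 / S + ε / 2) ∧
    (Real.sqrt (∑ e, max (fhat e - fbar e) 0 ^ 2)
      ≤ 4 * R / S + Real.sqrt (2 * ε / S)) := by
  have hL_pos : ∀ k ∈ range N, 0 < 1 / L (k + 1) := fun k hk =>
    one_div_pos.2 (hL (k + 1) (by omega) (by have := mem_range.1 hk; omega))
  have hS_pos : 0 < S := hS ▸ sum_pos hL_pos (nonempty_range_iff.2 hN.ne')
  have hΦ_zero : Φ 0 = 0 := by simp [hΦ]
  have hΦ_two : ∀ t : E → ℝ, Φ (fun e => 2 * t e) ≤ 2 * Φ t := by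
    intro t
    rw [hΦ, hΦ, mul_neg, neg_le_neg_iff, mul_sum]
    refine sum_le_sum fun w _ => ?_
    have h := mul_inf'_le_inf'_mul (hne w) (fun p => ∑ e, t e * a p e) zero_le_two
    simp only [mul_sum, ← mul_assoc] at h
    calc 2 * (d w * _) = d w * (2 * _) := by ring
      _ ≤ _ := mul_le_mul_of_nonneg_left h (hd w).le
  have h_affine : ∀ k ∈ range N, ∀ t : E → ℝ,
      Φ (tv k) + ∑ e, gv k e * (t e - tv k e) = ∑ e, gv k e * t e := by
    intro k hk t
    rw [eq_sum_mul_of_subgradient hΦ_zero (hΦ_two _) (hgsub k (mem_range.1 hk)),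
      ← sum_add_distrib]
    exact sum_congr rfl fun e _ => by ring
  have h_model : ∀ t : E → ℝ, (1 / S) * ∑ k ∈ range N, (1 / L (k + 1)) *
      (Φ (tv k) + ∑ e, gv k e * (t e - tv k e)) = -∑ e, fhat e * t e := by
    intro t
    rw [sum_congr rfl fun k hk => by rw [h_affine k hk t]]
    simp only [hfhat, neg_mul, sum_neg_distrib, neg_neg, mul_sum, sum_mul]
    rw [sum_comm]
    exact sum_congr rfl fun e _ => sum_congr rfl fun k _ => by ring
  have h_minorant : ∀ t : E → ℝ, -∑ e, fhat e * t e ≤ Φ t := by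
    intro t
    rw [← h_model t, one_div, inv_mul_le_iff₀ hS_pos, hS, sum_mul]
    exact sum_le_sum fun k hk =>
      mul_le_mul_of_nonneg_left (hgsub k (mem_range.1 hk) t) (hL_pos k hk).le
  have h_that : ∀ e, tbar e ≤ that e := by
    intro e
    rw [hthat, one_div, le_inv_mul_iff₀ hS_pos, hS, sum_mul]
    refine sum_le_sum fun k hk => ?_
    rw [div_eq_mul_one_div (tv (k + 1) e), mul_comm (tv (k + 1) e)]
    exact mul_le_mul_of_nonneg_left (htv (k + 1) (mem_range.1 hk) e) (hL_pos k hk).le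
  have hR_sq : R ^ 2 = ∑ e, (tstar e - tbar e) ^ 2 := by
    rw [hR, Real.sq_sqrt (sum_nonneg fun e _ => sq_nonneg _)]
  have h_gap : ∀ u : E → ℝ, (∀ e, 0 ≤ u e) →
      Q that + Ψ fhat + ∑ e, u e * (fhat e - fbar e) ≤ (∑ e, u e ^ 2) / S + ε / 2 := by
    intro u hu
    have h := hUGI (fun e => tbar e + u e) fun e => le_add_of_nonneg_right (hu e)
    rw [h_model] at h
    simp only [add_sub_cancel_left, mul_add, sum_add_distrib] at h
    simp only [hΨ, mul_sub, sum_sub_distrib, mul_comm (tbar _), mul_comm (u _) (fhat _)]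
    linarith
  have h_lower : 0 ≤ Q that + Ψ fhat + ∑ e, (tstar e - tbar e) * max (fhat e - fbar e) 0 := by
    have h1 := htstar_min that h_that
    have h2 := h_minorant tstar
    have h3 : ∑ e, (tstar e - tbar e) * (fhat e - fbar e)
        ≤ ∑ e, (tstar e - tbar e) * max (fhat e - fbar e) 0 :=
      sum_le_sum fun e _ =>
        mul_le_mul_of_nonneg_left (le_max_left _ _) (sub_nonneg.2 (htstar e))
    have h4 : ∑ e, (tstar e - tbar e) * fbar e + ∑ e, tbar e * fhat e
        + ∑ e, (tstar e - tbar e) * (fhat e - fbar e) = ∑ e, fhat e * tstar e := by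
      rw [← sum_add_distrib, ← sum_add_distrib]
      exact sum_congr rfl fun e _ => by ring
    have h5 := hQ tstar
    rw [hΨ]
    linarith
  refine ⟨?_, ⟨h_lower, ?_⟩, ?_⟩
  · have h1 := hUGI tstar htstar
    rw [h_model, ← hR_sq] at h1
    have h2 := h_minorant tstar
    have h3 := hQ tstar
    linarith
  · have h1 := h_gap (fun e => if 0 ≤ fhat e - fbar e then tstar e - tbar e else 0) fun e => by
      split_ifs
      exacts [sub_nonneg.2 (htstar e), le_rfl]
    have h2 : ∑ e, (if 0 ≤ fhat e - fbar e then tstar e - tbar e else 0) * (fhat e - fbar e)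
        = ∑ e, (tstar e - tbar e) * max (fhat e - fbar e) 0 := by
      refine sum_congr rfl fun e _ => ?_
      split_ifs with h
      · rw [max_eq_left h]
      · rw [max_eq_right (not_le.1 h).le, zero_mul, mul_zero]
    have h3 : ∑ e, (if 0 ≤ fhat e - fbar e then tstar e - tbar e else 0) ^ 2 ≤ R ^ 2 := by
      rw [hR_sq]
      refine sum_le_sum fun e _ => ?_
      split_ifs
      · exact le_rfl
      · simpa using sq_nonneg (tstar e - tbar e)
    have h4 := div_le_div_of_nonneg_right h3 hS_pos.le
    linarith
  · set n := Real.sqrt (∑ e, max (fhat e - fbar e) 0 ^ 2)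
    have hn_sq : n ^ 2 = ∑ e, max (fhat e - fbar e) 0 ^ 2 :=
      Real.sq_sqrt (sum_nonneg fun e _ => sq_nonneg _)
    have h_cauchy : ∑ e, (tstar e - tbar e) * max (fhat e - fbar e) 0 ≤ R * n := by
      rw [hR]
      exact Real.sum_mul_le_sqrt_mul_sqrt _ _ _
    have h1 := h_gap (fun e => S / 2 * max (fhat e - fbar e) 0) fun e =>
      mul_nonneg (half_pos hS_pos).le (le_max_right _ _)
    have h2 : ∑ e, S / 2 * max (fhat e - fbar e) 0 * (fhat e - fbar e) = S / 2 * n ^ 2 := by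
      rw [hn_sq, mul_sum]
      refine sum_congr rfl fun e _ => ?_
      rcases max_cases (fhat e - fbar e) 0 with ⟨h, _⟩ | ⟨h, _⟩ <;> rw [h] <;> ring
    have h3 : (∑ e, (S / 2 * max (fhat e - fbar e) 0) ^ 2) / S = S / 4 * n ^ 2 := by
      simp only [mul_pow]
      rw [← mul_sum, ← hn_sq]
      field_simp
      ring
    rw [h2, h3] at h1
    have h_quad : S * n ^ 2 - 4 * R * n ≤ 2 * ε := by linarith
    have hR_nonneg : 0 ≤ R := hR ▸ Real.sqrt_nonneg _
    refine le_add_of_sq_sub_mul_le_sq (by positivity) (Real.sqrt_nonneg _) ?_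
    rw [Real.sq_sqrt (show 0 ≤ 2 * ε / S by positivity), le_div_iff₀ hS_pos]
    calc (n ^ 2 - 4 * R / S * n) * S = S * n ^ 2 - 4 * R * n := by field_simp
      _ ≤ 2 * ε := h_quad
end

section
/- Theorem 3.2, first part (UGM complexity for the stable dynamics model): under the hypotheses of Lemma 3.1, assume additionally that L_k ≤ M²/ε for all k = 1, …, N, where M > 0 (so that S_N ≥ εN/M²). Then for every N ≥ 2(RM/ε)², Q(t̂^N) − Q(t*) ≤ ε. -/
open Finset

/-- Theorem 3.2, first part (UGM complexity for the stable dynamics model):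
under the hypotheses of Lemma 3.1 and `L_k ≤ M²/ε` for all `k = 1, …, N`,
for every `N ≥ 2(RM/ε)²` one has `Q(t̂^N) − Q(t*) ≤ ε`. -/
theorem ugm_stable_dynamics_complexity
    (E P W : Type) [Fintype E] [Fintype P] [Fintype W] [DecidableEq W]
    (a : P → E → ℝ) (ha : ∀ p e, a p e = 0 ∨ a p e = 1)
    (wOD : P → W) (d : W → ℝ) (hd : ∀ w, 0 < d w)
    (hne : ∀ w : W, (univ.filter (fun p => wOD p = w)).Nonempty)
    (Φ : (E → ℝ) → ℝ)
    (hΦ : ∀ t : E → ℝ, Φ t = -∑ w, d w *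
        (univ.filter (fun p => wOD p = w)).inf' (hne w) (fun p => ∑ e, t e * a p e))
    (tbar fbar : E → ℝ) (htbar : ∀ e, 0 < tbar e) (hfbar : ∀ e, 0 < fbar e)
    (Ψ : (E → ℝ) → ℝ) (hΨ : ∀ f : E → ℝ, Ψ f = ∑ e, tbar e * f e)
    (Q : (E → ℝ) → ℝ) (hQ : ∀ t : E → ℝ, Q t = Φ t + ∑ e, (t e - tbar e) * fbar e)
    (ε : ℝ) (hε : 0 < ε)
    (N : ℕ) (hN : 0 < N)
    (tv : ℕ → E → ℝ) (htv : ∀ k, k ≤ N → ∀ e, tbar e ≤ tv k e)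
    (L : ℕ → ℝ) (hL : ∀ k, 1 ≤ k → k ≤ N → 0 < L k)
    (gv : ℕ → E → ℝ)
    (hgsub : ∀ k, k < N → ∀ s : E → ℝ, Φ (tv k) + ∑ e, gv k e * (s e - tv k e) ≤ Φ s)
    (xv : ℕ → P → ℝ)
    (hxv0 : ∀ k, k < N → ∀ p, 0 ≤ xv k p)
    (hxvd : ∀ k, k < N → ∀ w, ∑ p ∈ univ.filter (fun p => wOD p = w), xv k p = d w)
    (hgx : ∀ k, k < N → ∀ e, gv k e = -(∑ p, a p e * xv k p))
    (S : ℝ) (hS : S = ∑ k ∈ range N, 1 / L (k + 1))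
    (that : E → ℝ)
    (hthat : ∀ e, that e = (1 / S) * ∑ k ∈ range N, tv (k + 1) e / L (k + 1))
    (fhat : E → ℝ)
    (hfhat : ∀ e, fhat e = -((1 / S) * ∑ k ∈ range N, gv k e / L (k + 1)))
    (hUGI : ∀ t : E → ℝ, (∀ e, tbar e ≤ t e) →
      Q that ≤ (1 / S) * ∑ k ∈ range N, (1 / L (k + 1)) *
          (Φ (tv k) + ∑ e, gv k e * (t e - tv k e))
        + ∑ e, (t e - tbar e) * fbar e + (∑ e, (t e - tbar e) ^ 2) / S + ε / 2)
    (tstar : E → ℝ) (htstar : ∀ e, tbar e ≤ tstar e)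
    (htstar_min : ∀ t : E → ℝ, (∀ e, tbar e ≤ t e) → Q tstar ≤ Q t)
    (R : ℝ) (hR : R = Real.sqrt (∑ e, (tstar e - tbar e) ^ 2))
    (M : ℝ) (hM : 0 < M)
    (hLM : ∀ k, 1 ≤ k → k ≤ N → L k ≤ M ^ 2 / ε)
    (hNbig : 2 * (R * M / ε) ^ 2 ≤ (N : ℝ)) :
    Q that - Q tstar ≤ ε := by
  have hLpos : ∀ k ∈ range N, 0 < L (k + 1) := fun k hk =>
    hL (k + 1) (by omega) (by have := mem_range.mp hk; omega)
  have hSpos : 0 < S := by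
    rw [hS]
    exact sum_pos (fun k hk => one_div_pos.mpr (hLpos k hk)) (nonempty_range_iff.mpr hN.ne')
  have hSlower : N * (ε / M ^ 2) ≤ S := by
    rw [hS]
    have h := card_nsmul_le_sum (range N) (fun k => 1 / L (k + 1)) (ε / M ^ 2) fun k hk => by
      rw [← one_div_div (M ^ 2) ε]
      exact one_div_le_one_div_of_le (hLpos k hk)
        (hLM (k + 1) (by omega) (by have := mem_range.mp hk; omega))
    simpa using h
  have hRsq : R ^ 2 = ∑ e, (tstar e - tbar e) ^ 2 := by
    rw [hR, Real.sq_sqrt (sum_nonneg fun e _ => sq_nonneg _)]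
  have hprox : (∑ e, (tstar e - tbar e) ^ 2) / S ≤ ε / 2 := by
    rw [← hRsq, div_le_iff₀ hSpos]
    calc R ^ 2 = ε / 2 * (2 * (R * M / ε) ^ 2 * (ε / M ^ 2)) := by field_simp
      _ ≤ ε / 2 * (N * (ε / M ^ 2)) := by gcongr
      _ ≤ ε / 2 * S := by gcongr
  have hlin : (1 / S) * ∑ k ∈ range N, (1 / L (k + 1)) *
      (Φ (tv k) + ∑ e, gv k e * (tstar e - tv k e)) ≤ Φ tstar := by
    calc _ ≤ (1 / S) * ∑ k ∈ range N, (1 / L (k + 1)) * Φ tstar := by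
          gcongr with k hk
          · exact (one_div_pos.mpr (hLpos k hk)).le
          · exact hgsub k (mem_range.mp hk) tstar
      _ = Φ tstar := by
          rw [← sum_mul, ← hS]
          field_simp
  linarith [hUGI tstar htstar, hQ tstar]
end

section
/- Theorem 3.2, second part (explicit duality-gap bound for UGM in the stable dynamics model): under the hypotheses of Lemma 3.1, assume L_k ≤ M²/ε for all k, let g = Θx' (x' ∈ X) satisfy ξ := 1 − max_e g_e/f̄_e > 0, let f* = Θx* (x* ∈ X) be a primal optimum, i.e. f* ≤ f̄ and Ψ(f*) = −Q(t*), and let π(f̂^N) = f̂^N if η ≤ 0 and π(f̂^N) = (ξ f̂^N + η g)/(ξ + η) if η > 0, where η = max_e f̂^N_e/f̄_e − 1. Then Q(t̂^N) + Ψ(π(f̂^N)) ≤ R²M²/(εN) + (⟨g − f*, t̄⟩/(ξ · min_e f̄_e)) · (4RM²/(εN) + √(2M²/N)) + ε/2. -/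
open Finset

/-- The total travel cost of a feasible path flow is at least the cost of routing every demand
along a shortest path. -/
theorem sum_demand_mul_inf'_le {E P W : Type*} [Fintype E] [Fintype P] [Fintype W] [DecidableEq W]
    (a : P → E → ℝ) (wOD : P → W) (d : W → ℝ)
    (hne : ∀ w : W, (univ.filter (fun p => wOD p = w)).Nonempty)
    (x : P → ℝ) (hx0 : ∀ p, 0 ≤ x p)
    (hxd : ∀ w, ∑ p ∈ univ.filter (fun p => wOD p = w), x p = d w) (t : E → ℝ) :
    ∑ w, d w * (univ.filter (fun p => wOD p = w)).inf' (hne w) (fun p => ∑ e, t e * a p e)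
      ≤ ∑ e, (∑ p, a p e * x p) * t e := by
  have h : ∑ e, (∑ p, a p e * x p) * t e
      = ∑ w, ∑ p ∈ univ.filter (fun p => wOD p = w), x p * ∑ e, t e * a p e := by
    rw [sum_fiberwise]
    simp_rw [sum_mul, mul_sum]
    rw [sum_comm]
    exact sum_congr rfl fun p _ => sum_congr rfl fun e _ => by ring
  rw [h]
  refine sum_le_sum fun w _ => ?_
  rw [← hxd w, sum_mul]
  exact sum_le_sum fun p hp => mul_le_mul_of_nonneg_left (inf'_le _ hp) (hx0 p)

/-- Any solution of `S / 4 * D ^ 2 ≤ R * D + ε / 2` is bounded by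
`4 * R / S + √(2 * ε / S)`. -/
theorem le_of_quadratic_bound {S R D ε : ℝ} (hS : 0 < S) (hR : 0 ≤ R) (hε : 0 ≤ ε)
    (h : S / 4 * D ^ 2 ≤ R * D + ε / 2) :
    D ≤ 4 * R / S + √(2 * ε / S) := by
  have hq : 0 ≤ √(2 * ε / S) := Real.sqrt_nonneg _
  have hq2 : √(2 * ε / S) ^ 2 = 2 * ε / S := Real.sq_sqrt (by positivity)
  set q := √(2 * ε / S)
  set r := 4 * R / S with hr
  have hr0 : 0 ≤ r := by positivity
  have h' : D ^ 2 ≤ r * D + q ^ 2 := by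
    have e1 : r * D + q ^ 2 = 4 / S * (R * D + ε / 2) := by rw [hq2, hr]; ring
    have e2 : D ^ 2 = 4 / S * (S / 4 * D ^ 2) := by field_simp
    rw [e1, e2]
    exact mul_le_mul_of_nonneg_left h (by positivity)
  by_contra! hD
  nlinarith [mul_nonneg hr0 hq, mul_pos (sub_pos.2 hD) (sub_pos.2 hD)]

/-- The pairing with a nonnegative vector is at most the norm of the positive part times the norm
of the vector. -/
theorem sum_mul_le_sqrt_posPart {E : Type*} [Fintype E] (y u : E → ℝ) (hu : ∀ e, 0 ≤ u e) :
    ∑ e, y e * u e ≤ √(∑ e, u e ^ 2) * √(∑ e, max (y e) 0 ^ 2) := by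
  refine le_trans (sum_le_sum fun e _ => ?_)
    (Real.sum_mul_le_sqrt_mul_sqrt univ u (fun e => max (y e) 0))
  rw [mul_comm]
  exact mul_le_mul_of_nonneg_left (le_max_left _ _) (hu e)

/-- Theorem 3.2, second part (explicit duality-gap bound for UGM in the stable
dynamics model): under the hypotheses of Lemma 3.1 with `L_k ≤ M²/ε`, given
admissible flows `g = Θx'` with `ξ := 1 − max_e g_e/f̄_e > 0`, a primal optimum
`f* = Θx*` (with `f* ≤ f̄` and `Ψ(f*) = −Q(t*)`), and the reconstructed flows
`π(f̂^N)`, one has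
`Q(t̂^N) + Ψ(π(f̂^N)) ≤ R²M²/(εN) + (⟨g − f*, t̄⟩/(ξ·min_e f̄_e))·(4RM²/(εN) + √(2M²/N)) + ε/2`. -/
theorem ugm_stable_dynamics_gap_bound
    (E P W : Type) [Fintype E] [Fintype P] [Fintype W] [DecidableEq W] [Nonempty E]
    (a : P → E → ℝ) (ha : ∀ p e, a p e = 0 ∨ a p e = 1)
    (wOD : P → W) (d : W → ℝ) (hd : ∀ w, 0 < d w)
    (hne : ∀ w : W, (univ.filter (fun p => wOD p = w)).Nonempty)
    (Φ : (E → ℝ) → ℝ)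
    (hΦ : ∀ t : E → ℝ, Φ t = -∑ w, d w *
        (univ.filter (fun p => wOD p = w)).inf' (hne w) (fun p => ∑ e, t e * a p e))
    (tbar fbar : E → ℝ) (htbar : ∀ e, 0 < tbar e) (hfbar : ∀ e, 0 < fbar e)
    (Ψ : (E → ℝ) → ℝ) (hΨ : ∀ f : E → ℝ, Ψ f = ∑ e, tbar e * f e)
    (Q : (E → ℝ) → ℝ) (hQ : ∀ t : E → ℝ, Q t = Φ t + ∑ e, (t e - tbar e) * fbar e)
    (ε : ℝ) (hε : 0 < ε)
    (N : ℕ) (hN : 0 < N)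
    (tv : ℕ → E → ℝ) (htv : ∀ k, k ≤ N → ∀ e, tbar e ≤ tv k e)
    (L : ℕ → ℝ) (hL : ∀ k, 1 ≤ k → k ≤ N → 0 < L k)
    (gv : ℕ → E → ℝ)
    (hgsub : ∀ k, k < N → ∀ s : E → ℝ, Φ (tv k) + ∑ e, gv k e * (s e - tv k e) ≤ Φ s)
    (xv : ℕ → P → ℝ)
    (hxv0 : ∀ k, k < N → ∀ p, 0 ≤ xv k p)
    (hxvd : ∀ k, k < N → ∀ w, ∑ p ∈ univ.filter (fun p => wOD p = w), xv k p = d w)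
    (hgx : ∀ k, k < N → ∀ e, gv k e = -(∑ p, a p e * xv k p))
    (S : ℝ) (hS : S = ∑ k ∈ range N, 1 / L (k + 1))
    (that : E → ℝ)
    (hthat : ∀ e, that e = (1 / S) * ∑ k ∈ range N, tv (k + 1) e / L (k + 1))
    (fhat : E → ℝ)
    (hfhat : ∀ e, fhat e = -((1 / S) * ∑ k ∈ range N, gv k e / L (k + 1)))
    (hUGI : ∀ t : E → ℝ, (∀ e, tbar e ≤ t e) →
      Q that ≤ (1 / S) * ∑ k ∈ range N, (1 / L (k + 1)) *
          (Φ (tv k) + ∑ e, gv k e * (t e - tv k e))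
        + ∑ e, (t e - tbar e) * fbar e + (∑ e, (t e - tbar e) ^ 2) / S + ε / 2)
    (tstar : E → ℝ) (htstar : ∀ e, tbar e ≤ tstar e)
    (htstar_min : ∀ t : E → ℝ, (∀ e, tbar e ≤ t e) → Q tstar ≤ Q t)
    (R : ℝ) (hR : R = Real.sqrt (∑ e, (tstar e - tbar e) ^ 2))
    (M : ℝ) (hM : 0 < M)
    (hLM : ∀ k, 1 ≤ k → k ≤ N → L k ≤ M ^ 2 / ε)
    -- admissible flows g = Θx'
    (x' : P → ℝ) (hx'0 : ∀ p, 0 ≤ x' p)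
    (hx'd : ∀ w, ∑ p ∈ univ.filter (fun p => wOD p = w), x' p = d w)
    (g : E → ℝ) (hg : ∀ e, g e = ∑ p, a p e * x' p)
    (ξ : ℝ) (hξ : ξ = 1 - univ.sup' univ_nonempty (fun e => g e / fbar e))
    (hξpos : 0 < ξ)
    -- primal optimum f* = Θx*
    (xs : P → ℝ) (hxs0 : ∀ p, 0 ≤ xs p)
    (hxsd : ∀ w, ∑ p ∈ univ.filter (fun p => wOD p = w), xs p = d w)
    (fstar : E → ℝ) (hfstar : ∀ e, fstar e = ∑ p, a p e * xs p)
    (hfstar_cap : ∀ e, fstar e ≤ fbar e)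
    (hfstar_opt : Ψ fstar = -Q tstar)
    -- reconstruction π(f̂^N)
    (η : ℝ) (hη : η = univ.sup' univ_nonempty (fun e => fhat e / fbar e) - 1)
    (πf : E → ℝ)
    (hπf : πf = if η ≤ 0 then fhat else fun e => (ξ * fhat e + η * g e) / (ξ + η)) :
    Q that + Ψ πf
      ≤ R ^ 2 * M ^ 2 / (ε * N)
        + ((∑ e, (g e - fstar e) * tbar e) / (ξ * univ.inf' univ_nonempty fbar)) *
            (4 * R * M ^ 2 / (ε * N) + Real.sqrt (2 * M ^ 2 / N))
        + ε / 2 := by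
  have hLk : ∀ k ∈ range N, 0 < L (k + 1) := fun k hk =>
    hL (k + 1) (by omega) (by have := mem_range.1 hk; omega)
  have hNr : (0 : ℝ) < N := by exact_mod_cast hN
  have hSlow : N * ε / M ^ 2 ≤ S := by
    have h : ∑ k ∈ range N, ε / M ^ 2 ≤ S := by
      rw [hS]
      refine sum_le_sum fun k hk => ?_
      have h1 := hLM (k + 1) (by omega) (by have := mem_range.1 hk; omega)
      have h2 := one_div_le_one_div_of_le (hLk k hk) h1
      rwa [one_div_div] at h2
    rw [sum_const, card_range, nsmul_eq_mul] at h
    rwa [mul_div_assoc]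
  have hSpos : 0 < S := lt_of_lt_of_le (by positivity) hSlow
  have hSinv : 1 / S ≤ M ^ 2 / (ε * N) := by
    have h := one_div_le_one_div_of_le (by positivity) hSlow
    rwa [one_div_div, mul_comm (N : ℝ) ε] at h
  have hweight : (1 / S) * ∑ k ∈ range N, 1 / L (k + 1) = 1 := by
    rw [← hS]; field_simp
  have hΦ0 : Φ 0 = 0 := by simp [hΦ]
  have hfeas : ∀ x : P → ℝ, (∀ p, 0 ≤ x p) →
      (∀ w, ∑ p ∈ univ.filter (fun p => wOD p = w), x p = d w) → ∀ t : E → ℝ,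
      -(∑ e, (∑ p, a p e * x p) * t e) ≤ Φ t := fun x hx0 hxd t => by
    rw [hΦ]
    exact neg_le_neg (sum_demand_mul_inf'_le a wOD d hne x hx0 hxd t)
  have hfhat_pair : ∀ t : E → ℝ, ∑ e, fhat e * t e
      = -((1 / S) * ∑ k ∈ range N, (1 / L (k + 1)) * ∑ e, gv k e * t e) := fun t => by
    simp_rw [hfhat, neg_mul, sum_neg_distrib, mul_sum, sum_mul]
    rw [sum_comm]
    exact congrArg _ (sum_congr rfl fun k _ => sum_congr rfl fun e _ => by ring)
  have hmodel : ∀ t : E → ℝ, (∀ e, tbar e ≤ t e) →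
      Q that ≤ -(∑ e, fhat e * t e) + ∑ e, (t e - tbar e) * fbar e
        + (∑ e, (t e - tbar e) ^ 2) / S + ε / 2 := fun t ht => by
    refine (hUGI t ht).trans ?_
    rw [hfhat_pair, neg_neg]
    gcongr with k hk
    · exact (one_div_pos.2 (hLk k hk)).le
    · have h := hgsub k (mem_range.1 hk) 0
      simp only [hΦ0, Pi.zero_apply, zero_sub, mul_neg, sum_neg_distrib] at h
      simp only [mul_sub, sum_sub_distrib]
      linarith
  have hfhat_feas : ∀ t : E → ℝ, -(∑ e, fhat e * t e) ≤ Φ t := fun t => by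
    have h : (1 / S) * ∑ k ∈ range N, (1 / L (k + 1)) * ∑ e, gv k e * t e
        ≤ (1 / S) * ∑ k ∈ range N, (1 / L (k + 1)) * Φ t := by
      gcongr with k hk
      · exact (one_div_pos.2 (hLk k hk)).le
      · have hk' := mem_range.1 hk
        have h := hfeas (xv k) (hxv0 k hk') (hxvd k hk') t
        simp_rw [hgx k hk', neg_mul, sum_neg_distrib]
        exact h
    rw [← sum_mul, ← mul_assoc, hweight, one_mul] at h
    rw [hfhat_pair, neg_neg]
    exact h
  have hthat_ge : ∀ e, tbar e ≤ that e := fun e => by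
    have h : (1 / S) * ∑ k ∈ range N, (1 / L (k + 1)) * tbar e ≤ that e := by
      rw [hthat]
      gcongr with k hk
      rw [mul_comm, div_eq_mul_one_div (tv (k + 1) e)]
      exact mul_le_mul_of_nonneg_right (htv (k + 1) (mem_range.1 hk) e)
        (one_div_pos.2 (hLk k hk)).le
    rwa [← sum_mul, ← mul_assoc, hweight, one_mul] at h
  have hQopt : Q tstar ≤ Q that := htstar_min that hthat_ge
  have hR0 : 0 ≤ R := hR ▸ Real.sqrt_nonneg _
  have hR2 : R ^ 2 = ∑ e, (tstar e - tbar e) ^ 2 := by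
    rw [hR]; exact Real.sq_sqrt (sum_nonneg fun e _ => sq_nonneg _)
  have hduality : ∀ f : E → ℝ, -(∑ e, f e * tstar e) ≤ Φ tstar →
      -(∑ e, (f e - fbar e) * (tstar e - tbar e)) ≤ Q tstar + Ψ f := fun f hf => by
    rw [hQ, hΨ]
    have h : -(∑ e, (f e - fbar e) * (tstar e - tbar e)) = -(∑ e, f e * tstar e)
        + ∑ e, (tstar e - tbar e) * fbar e + ∑ e, tbar e * f e := by
      rw [← sum_neg_distrib, ← sum_neg_distrib, ← sum_add_distrib, ← sum_add_distrib]
      exact sum_congr rfl fun e _ => by ring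
    linarith
  set v : E → ℝ := fun e => max (fhat e - fbar e) 0 with hv
  have hv0 : ∀ e, 0 ≤ v e := fun e => le_max_right _ _
  set D : ℝ := √(∑ e, v e ^ 2)
  have hD2 : D ^ 2 = ∑ e, v e ^ 2 := Real.sq_sqrt (sum_nonneg fun e _ => sq_nonneg _)
  have hupper : Q that + Ψ fhat + S / 4 * D ^ 2 ≤ ε / 2 := by
    have h := hmodel (fun e => tbar e + S / 2 * v e) fun e =>
      le_add_of_nonneg_right (mul_nonneg (by positivity) (hv0 e))
    have h' : -(∑ e, fhat e * (tbar e + S / 2 * v e))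
        + ∑ e, (tbar e + S / 2 * v e - tbar e) * fbar e
        + (∑ e, (tbar e + S / 2 * v e - tbar e) ^ 2) / S = -Ψ fhat - S / 4 * D ^ 2 := by
      rw [hΨ, hD2, sum_div, mul_sum, ← sum_neg_distrib, ← sum_neg_distrib, ← sum_add_distrib,
        ← sum_add_distrib, ← sum_sub_distrib]
      refine sum_congr rfl fun e _ => ?_
      have hve : (fhat e - fbar e) * v e = v e ^ 2 := by
        rcases le_total (fhat e - fbar e) 0 with h | h
        · simp [hv, max_eq_right h]
        · simp only [hv, max_eq_left h]; ring
      have hsq : (tbar e + S / 2 * v e - tbar e) ^ 2 / S = S / 4 * v e ^ 2 := by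
        field_simp
        ring
      linear_combination hsq - S / 2 * hve
    linarith
  have hlower : -(R * D) ≤ Q tstar + Ψ fhat := by
    have h := sum_mul_le_sqrt_posPart (fun e => fhat e - fbar e) (fun e => tstar e - tbar e)
      fun e => sub_nonneg.2 (htstar e)
    rw [← hR] at h
    exact (neg_le_neg h).trans (hduality fhat (hfhat_feas tstar))
  have hDbound : D ≤ 4 * R * M ^ 2 / (ε * N) + √(2 * M ^ 2 / N) := by
    refine (le_of_quadratic_bound hSpos hR0 hε.le (by linarith)).trans (add_le_add ?_ ?_)
    · rw [div_eq_mul_one_div, mul_div_assoc]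
      exact mul_le_mul_of_nonneg_left hSinv (by positivity)
    · apply Real.sqrt_le_sqrt
      calc 2 * ε / S = 2 * ε * (1 / S) := div_eq_mul_one_div _ _
        _ ≤ 2 * ε * (M ^ 2 / (ε * N)) := mul_le_mul_of_nonneg_left hSinv (by positivity)
        _ = 2 * M ^ 2 / N := by field_simp
  have hRS : R ^ 2 / S ≤ R ^ 2 * M ^ 2 / (ε * N) := by
    rw [div_eq_mul_one_div, mul_div_assoc]
    exact mul_le_mul_of_nonneg_left hSinv (by positivity)
  have hRS0 : 0 ≤ R ^ 2 / S := by positivity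
  have hQgap : Q that ≤ Q tstar + R ^ 2 / S + ε / 2 := by
    have h := hmodel tstar htstar
    rw [← hR2] at h
    have h1 := hfhat_feas tstar
    rw [hQ tstar]
    linarith
  have hgcap : ∀ e, g e ≤ fbar e := fun e => by
    have h := le_sup' (fun e => g e / fbar e) (mem_univ e)
    exact (div_le_one (hfbar e)).1 (by linarith)
  have hG : ∑ e, (g e - fstar e) * tbar e = Ψ g - Ψ fstar := by
    rw [hΨ, hΨ, ← sum_sub_distrib]
    exact sum_congr rfl fun e _ => by ring
  have hG0 : 0 ≤ Ψ g - Ψ fstar := by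
    have h1 := hfeas x' hx'0 hx'd tstar
    simp_rw [← hg] at h1
    have h2 : ∑ e, (g e - fbar e) * (tstar e - tbar e) ≤ 0 := sum_nonpos fun e _ =>
      mul_nonpos_of_nonpos_of_nonneg (sub_nonpos.2 (hgcap e)) (sub_nonneg.2 (htstar e))
    linarith [hduality g h1]
  set m := univ.inf' univ_nonempty fbar
  have hmpos : 0 < m := (lt_inf'_iff _).2 fun e _ => hfbar e
  rw [hG]
  set G := Ψ g - Ψ fstar
  have hDstep : G / (ξ * m) * D
      ≤ G / (ξ * m) * (4 * R * M ^ 2 / (ε * N) + √(2 * M ^ 2 / N)) :=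
    mul_le_mul_of_nonneg_left hDbound (by positivity)
  have hSD : 0 ≤ S / 4 * D ^ 2 := by positivity
  rcases le_or_gt η 0 with hη0 | hη0
  · rw [hπf, if_pos hη0]
    have : 0 ≤ G / (ξ * m) * D := by positivity
    linarith
  · have hηD : η * m ≤ D := by
      obtain ⟨e, -, he⟩ := exists_mem_eq_sup' univ_nonempty (fun e => fhat e / fbar e)
      have hηe : η * fbar e = fhat e - fbar e := by
        have := (hfbar e).ne'
        rw [hη, he]
        field_simp
      calc η * m ≤ η * fbar e := mul_le_mul_of_nonneg_left (inf'_le _ (mem_univ e)) hη0.le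
        _ ≤ v e := hηe ▸ le_max_left _ _
        _ ≤ D := Real.le_sqrt_of_sq_le
          (single_le_sum (f := fun e => v e ^ 2) (fun e _ => sq_nonneg _) (mem_univ e))
    have hπ : Ψ πf = (ξ * Ψ fhat + η * Ψ g) / (ξ + η) := by
      rw [hπf, if_neg hη0.not_ge]
      simp only [hΨ, mul_sum]
      rw [← sum_add_distrib, sum_div]
      exact sum_congr rfl fun e _ => by ring
    have hηG : η / ξ * G ≤ G / (ξ * m) * D := by
      have h : η / ξ * G = G / (ξ * m) * (η * m) := by field_simp
      rw [h]
      exact mul_le_mul_of_nonneg_left hηD (by positivity)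
    have hmain : Q that + Ψ πf ≤ R ^ 2 / S + η / ξ * G + ε / 2 := by
      have hsum : 0 < ξ + η := by positivity
      have h1 : Q that + Ψ πf
          = (ξ * (Q that + Ψ fhat) + η * (Q that + Ψ g)) / (ξ + η) := by
        rw [hπ]; field_simp; ring
      rw [h1, div_le_iff₀ hsum]
      have h2 : ξ * (Q that + Ψ fhat) ≤ ξ * (ε / 2) :=
        mul_le_mul_of_nonneg_left (by linarith) hξpos.le
      have h3 : η * (Q that + Ψ g) ≤ η * (R ^ 2 / S + ε / 2 + G) :=
        mul_le_mul_of_nonneg_left (by simp only [G]; linarith) hη0.le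
      have h4 : η / ξ * G * (ξ + η) = η * G + η / ξ * G * η := by field_simp
      have h5 : 0 ≤ η / ξ * G * η := by positivity
      have h6 : 0 ≤ R ^ 2 / S * ξ := mul_nonneg hRS0 hξpos.le
      rw [add_mul, add_mul, h4]
      linarith
    linarith
end

section
/- Theorem 3.4 (UGM complexity for the Beckmann model): under the hypotheses of Lemma 3.3, assume additionally L_k ≤ M²/ε for all k = 1, …, N (so S_N ≥ εN/M²) and that f̂^N_e ≤ ∑_w d_w for all e ∈ E. Then for every N ≥ 2(RM/ε)², Q(t̂^N) − Q(t*) ≤ ε; and for every N ≥ 2(R̃M/ε)², the duality gap satisfies Q(t̂^N) + Ψ(f̂^N) ≤ ε, where R̃² = ρ² ∑_e (t̄_e²/f̄_e^{2/μ}) (∑_w d_w)^{2/μ}. -/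
open Finset

/-- The integral of the Beckmann link cost `z ↦ tb * (1 + ρ * (z / fb) ^ (1 / μ))`. -/
lemma integral_beckmann_cost {tb fb ρ μ x : ℝ} (hfb : 0 < fb) (hμ : 0 < μ) (hx : 0 ≤ x) :
    ∫ z in (0:ℝ)..x, tb * (1 + ρ * (z / fb) ^ (1 / μ)) =
      tb * x + tb * ρ * (x / fb) ^ (1 / μ) * x * (μ / (1 + μ)) := by
  have hp : 0 < 1 / μ := by positivity
  have hcont : Continuous fun z : ℝ => ρ * (z / fb) ^ (1 / μ) :=
    continuous_const.mul ((continuous_id.div_const fb).rpow_const fun _ => Or.inr hp.le)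
  rw [intervalIntegral.integral_const_mul,
    intervalIntegral.integral_add intervalIntegrable_const (hcont.intervalIntegrable 0 x),
    intervalIntegral.integral_const_mul, intervalIntegral.integral_const,
    intervalIntegral.integral_comp_div (fun z : ℝ => z ^ (1 / μ)) hfb.ne',
    integral_rpow (Or.inl (by linarith)), zero_div, Real.zero_rpow (by positivity),
    Real.rpow_add_one' (by positivity) (by positivity)]
  simp only [smul_eq_mul]
  field_simp
  ring

/-- The Fenchel equality for the Beckmann link cost and the conjugate of its primitive. -/
lemma beckmann_fenchel_eq {tb fb ρ μ x : ℝ} (htb : 0 < tb) (hfb : 0 < fb) (hρ : 0 < ρ)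
    (hμ : 0 < μ) (hx : 0 ≤ x) :
    fb * ((tb * (1 + ρ * (x / fb) ^ (1 / μ)) - tb) / (tb * ρ)) ^ μ *
        (tb * (1 + ρ * (x / fb) ^ (1 / μ)) - tb) / (1 + μ) =
      x * (tb * (1 + ρ * (x / fb) ^ (1 / μ))) -
        ∫ z in (0:ℝ)..x, tb * (1 + ρ * (z / fb) ^ (1 / μ)) := by
  rw [integral_beckmann_cost hfb hμ hx]
  have h1 : (tb * (1 + ρ * (x / fb) ^ (1 / μ)) - tb) / (tb * ρ) = (x / fb) ^ (1 / μ) := by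
    field_simp
    ring
  rw [h1, ← Real.rpow_mul (by positivity), one_div_mul_cancel hμ.ne', Real.rpow_one]
  generalize (x / fb) ^ (1 / μ) = y
  field_simp
  ring

/-- The squared excess of the Beckmann link cost over the free-flow cost, for bounded flow. -/
lemma beckmann_cost_sub_sq_le {tb fb ρ μ x D : ℝ} (hfb : 0 < fb) (hμ : 0 < μ) (hx : 0 ≤ x)
    (hxD : x ≤ D) :
    (tb * (1 + ρ * (x / fb) ^ (1 / μ)) - tb) ^ 2 ≤
      ρ ^ 2 * (tb ^ 2 / fb ^ (2 / μ) * D ^ (2 / μ)) := by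
  have h1 : ((x / fb) ^ (1 / μ)) ^ 2 = x ^ (2 / μ) / fb ^ (2 / μ) := by
    rw [← Real.rpow_natCast, ← Real.rpow_mul (by positivity), ← Real.div_rpow hx hfb.le]
    congr 1
    push_cast
    ring
  have h2 : x ^ (2 / μ) ≤ D ^ (2 / μ) := Real.rpow_le_rpow hx hxD (by positivity)
  calc (tb * (1 + ρ * (x / fb) ^ (1 / μ)) - tb) ^ 2
      = ρ ^ 2 * (tb ^ 2 / fb ^ (2 / μ) * x ^ (2 / μ)) := by
        rw [show (tb * (1 + ρ * (x / fb) ^ (1 / μ)) - tb) ^ 2 =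
          tb ^ 2 * ρ ^ 2 * ((x / fb) ^ (1 / μ)) ^ 2 by ring, h1]
        ring
    _ ≤ _ := by gcongr

/-- A sum of reciprocals of numbers in `(0, B]` is at least the number of terms over `B`. -/
lemma card_div_le_sum_one_div {L : ℕ → ℝ} {B : ℝ} {N : ℕ}
    (hL : ∀ k, 1 ≤ k → k ≤ N → 0 < L k) (hLB : ∀ k, 1 ≤ k → k ≤ N → L k ≤ B) :
    N / B ≤ ∑ k ∈ range N, 1 / L (k + 1) := by
  calc (N : ℝ) / B = ∑ _k ∈ range N, 1 / B := by simp [div_eq_mul_inv]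
    _ ≤ _ := sum_le_sum fun k hk =>
      one_div_le_one_div_of_le (hL _ (by omega) (by have := mem_range.1 hk; omega))
        (hLB _ (by omega) (by have := mem_range.1 hk; omega))

/-- If `N ≥ 2 (r M / ε)²` and `S ≥ N ε / M²`, then any `c ≤ r²` satisfies `c / S ≤ ε / 2`. -/
lemma div_le_half_of_iteration_bound {c r M ε S N : ℝ} (hc : c ≤ r ^ 2) (hM : 0 < M) (hε : 0 < ε)
    (hS : 0 < S) (hNS : N / (M ^ 2 / ε) ≤ S) (hN : 2 * (r * M / ε) ^ 2 ≤ N) :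
    c / S ≤ ε / 2 := by
  rw [div_le_iff₀ hS]
  calc c ≤ r ^ 2 := hc
    _ = ε / 2 * (2 * (r * M / ε) ^ 2 / (M ^ 2 / ε)) := by field_simp
    _ ≤ ε / 2 * (N / (M ^ 2 / ε)) := by gcongr
    _ ≤ ε / 2 * S := by gcongr

/-- Theorem 3.4 (UGM complexity for the Beckmann model): under the hypotheses
of Lemma 3.3, with `L_k ≤ M²/ε` for all `k` and `f̂^N_e ≤ ∑_w d_w` for all `e`,
for every `N ≥ 2(RM/ε)²` one has `Q(t̂^N) − Q(t*) ≤ ε`, and for every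
`N ≥ 2(R̃M/ε)²` the duality gap satisfies `Q(t̂^N) + Ψ(f̂^N) ≤ ε`, where
`R̃² = ρ² ∑_e (t̄_e²/f̄_e^{2/μ}) (∑_w d_w)^{2/μ}`. -/
theorem ugm_beckmann_complexity
    (E P W : Type) [Fintype E] [Fintype P] [Fintype W] [DecidableEq W]
    (a : P → E → ℝ) (ha : ∀ p e, a p e = 0 ∨ a p e = 1)
    (wOD : P → W) (d : W → ℝ) (hd : ∀ w, 0 < d w)
    (hne : ∀ w : W, (univ.filter (fun p => wOD p = w)).Nonempty)
    (Φ : (E → ℝ) → ℝ)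
    (hΦ : ∀ t : E → ℝ, Φ t = -∑ w, d w *
        (univ.filter (fun p => wOD p = w)).inf' (hne w) (fun p => ∑ e, t e * a p e))
    (tbar fbar : E → ℝ) (htbar : ∀ e, 0 < tbar e) (hfbar : ∀ e, 0 < fbar e)
    (ρ μ : ℝ) (hρ : 0 < ρ) (hμ0 : 0 < μ) (hμ1 : μ ≤ 1)
    (τ : E → ℝ → ℝ)
    (hτ : ∀ e (x : ℝ), τ e x = tbar e * (1 + ρ * (x / fbar e) ^ (1 / μ)))
    (σ : E → ℝ → ℝ) (hσ : ∀ e (x : ℝ), σ e x = ∫ z in (0:ℝ)..x, τ e z)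
    (Ψ : (E → ℝ) → ℝ) (hΨ : ∀ f : E → ℝ, Ψ f = ∑ e, σ e (f e))
    (σs : E → ℝ → ℝ)
    (hσs : ∀ e (te : ℝ), σs e te =
      fbar e * ((te - tbar e) / (tbar e * ρ)) ^ μ * (te - tbar e) / (1 + μ))
    (Q : (E → ℝ) → ℝ) (hQ : ∀ t : E → ℝ, Q t = Φ t + ∑ e, σs e (t e))
    (ε : ℝ) (hε : 0 < ε)
    (N : ℕ) (hN : 0 < N)
    (tv : ℕ → E → ℝ) (htv : ∀ k, k ≤ N → ∀ e, tbar e ≤ tv k e)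
    (L : ℕ → ℝ) (hL : ∀ k, 1 ≤ k → k ≤ N → 0 < L k)
    (gv : ℕ → E → ℝ)
    (hgsub : ∀ k, k < N → ∀ s : E → ℝ, Φ (tv k) + ∑ e, gv k e * (s e - tv k e) ≤ Φ s)
    (xv : ℕ → P → ℝ)
    (hxv0 : ∀ k, k < N → ∀ p, 0 ≤ xv k p)
    (hxvd : ∀ k, k < N → ∀ w, ∑ p ∈ univ.filter (fun p => wOD p = w), xv k p = d w)
    (hgx : ∀ k, k < N → ∀ e, gv k e = -(∑ p, a p e * xv k p))
    (S : ℝ) (hS : S = ∑ k ∈ range N, 1 / L (k + 1))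
    (that : E → ℝ)
    (hthat : ∀ e, that e = (1 / S) * ∑ k ∈ range N, tv (k + 1) e / L (k + 1))
    (fhat : E → ℝ)
    (hfhat : ∀ e, fhat e = -((1 / S) * ∑ k ∈ range N, gv k e / L (k + 1)))
    (hUGI : ∀ t : E → ℝ, (∀ e, tbar e ≤ t e) →
      Q that ≤ (1 / S) * ∑ k ∈ range N, (1 / L (k + 1)) *
          (Φ (tv k) + ∑ e, gv k e * (t e - tv k e))
        + ∑ e, σs e (t e) + (∑ e, (t e - tbar e) ^ 2) / S + ε / 2)
    (tstar : E → ℝ) (htstar : ∀ e, tbar e ≤ tstar e)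
    (htstar_min : ∀ t : E → ℝ, (∀ e, tbar e ≤ t e) → Q tstar ≤ Q t)
    (R : ℝ) (hR : R = Real.sqrt (∑ e, (tstar e - tbar e) ^ 2))
    (M : ℝ) (hM : 0 < M)
    (hLM : ∀ k, 1 ≤ k → k ≤ N → L k ≤ M ^ 2 / ε)
    (hfhatD : ∀ e, fhat e ≤ ∑ w, d w)
    (Rt : ℝ)
    (hRt : Rt = Real.sqrt (ρ ^ 2 *
      ∑ e, tbar e ^ 2 / fbar e ^ (2 / μ) * (∑ w, d w) ^ (2 / μ))) :
    (2 * (R * M / ε) ^ 2 ≤ (N : ℝ) → Q that - Q tstar ≤ ε) ∧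
    (2 * (Rt * M / ε) ^ 2 ≤ (N : ℝ) → Q that + Ψ fhat ≤ ε) := by
  have hNS : (N : ℝ) / (M ^ 2 / ε) ≤ S := hS ▸ card_div_le_sum_one_div hL hLM
  have hNpos : (0 : ℝ) < N := by exact_mod_cast hN
  have hSpos : 0 < S := lt_of_lt_of_le (by positivity) hNS
  have hLpos : ∀ k ∈ range N, 0 < L (k + 1) := fun k hk =>
    hL _ (by omega) (by have := mem_range.1 hk; omega)
  constructor
  · intro hNb
    have hlin : (1 / S) * ∑ k ∈ range N, (1 / L (k + 1)) *
        (Φ (tv k) + ∑ e, gv k e * (tstar e - tv k e)) ≤ Φ tstar := by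
      calc _ ≤ (1 / S) * ∑ k ∈ range N, (1 / L (k + 1)) * Φ tstar := by
            refine mul_le_mul_of_nonneg_left (sum_le_sum fun k hk => ?_) (by positivity)
            exact mul_le_mul_of_nonneg_left (hgsub k (mem_range.1 hk) tstar)
              (one_div_pos.2 (hLpos k hk)).le
        _ = Φ tstar := by
            rw [← sum_mul, ← hS]
            field_simp
    have hquad : (∑ e, (tstar e - tbar e) ^ 2) / S ≤ ε / 2 :=
      div_le_half_of_iteration_bound
        (by rw [hR, Real.sq_sqrt (sum_nonneg fun e _ => sq_nonneg _)]) hM hε hSpos hNS hNb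
    have hU := hUGI tstar htstar
    rw [hQ tstar]
    linarith
  · intro hNb
    have hf0 : ∀ e, 0 ≤ fhat e := by
      intro e
      rw [hfhat e, ← mul_neg, ← sum_neg_distrib]
      refine mul_nonneg (by positivity) (sum_nonneg fun k hk => ?_)
      rw [hgx k (mem_range.1 hk) e, neg_div, neg_neg]
      refine div_nonneg (sum_nonneg fun p _ => mul_nonneg ?_ (hxv0 k (mem_range.1 hk) p))
        (hLpos k hk).le
      rcases ha p e with h | h <;> simp [h]
    have hΦ0 : Φ 0 = 0 := by simp [hΦ]
    set t : E → ℝ := fun e => τ e (fhat e) with ht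
    have htge : ∀ e, tbar e ≤ t e := by
      intro e
      have h1 : 0 ≤ ρ * (fhat e / fbar e) ^ (1 / μ) :=
        mul_nonneg hρ.le (Real.rpow_nonneg (div_nonneg (hf0 e) (hfbar e).le) _)
      simp only [ht, hτ]
      nlinarith [htbar e]
    have hlin : (1 / S) * ∑ k ∈ range N, (1 / L (k + 1)) *
        (Φ (tv k) + ∑ e, gv k e * (t e - tv k e)) ≤ -∑ e, fhat e * t e := by
      calc _ ≤ (1 / S) * ∑ k ∈ range N, (1 / L (k + 1)) * ∑ e, gv k e * t e := by
            refine mul_le_mul_of_nonneg_left (sum_le_sum fun k hk => ?_) (by positivity)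
            refine mul_le_mul_of_nonneg_left ?_ (one_div_pos.2 (hLpos k hk)).le
            have h0 := hgsub k (mem_range.1 hk) 0
            simp only [hΦ0, Pi.zero_apply, zero_sub, mul_neg, sum_neg_distrib] at h0
            simp only [mul_sub, sum_sub_distrib]
            linarith
        _ = -∑ e, fhat e * t e := by
            simp only [hfhat, neg_mul, sum_neg_distrib, neg_neg, mul_sum, sum_mul]
            rw [sum_comm]
            exact sum_congr rfl fun e _ => sum_congr rfl fun k _ => by ring
    have hconj : ∑ e, σs e (t e) = ∑ e, fhat e * t e - Ψ fhat := by
      rw [hΨ, ← sum_sub_distrib]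
      refine sum_congr rfl fun e _ => ?_
      simp only [hσs, hσ, ht, hτ]
      exact beckmann_fenchel_eq (htbar e) (hfbar e) hρ hμ0 (hf0 e)
    have hD : 0 ≤ ∑ w, d w := sum_nonneg fun w _ => (hd w).le
    have hquad : (∑ e, (t e - tbar e) ^ 2) / S ≤ ε / 2 := by
      refine div_le_half_of_iteration_bound ?_ hM hε hSpos hNS hNb
      rw [hRt, Real.sq_sqrt (mul_nonneg (sq_nonneg _) (sum_nonneg fun e _ =>
        mul_nonneg (div_nonneg (sq_nonneg _) (Real.rpow_nonneg (hfbar e).le _))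
          (Real.rpow_nonneg hD _))), mul_sum]
      refine sum_le_sum fun e _ => ?_
      simp only [ht, hτ]
      exact beckmann_cost_sub_sq_le (hfbar e) hμ0 (hf0 e) (hfhatD e)
    have hU := hUGI t htge
    linarith
end

section
/- Lower bound on the UMST step-size accumulation: let ε, M > 0 and let sequences (L_k)_{k≥0}, (α_k)_{k≥1}, (A_k)_{k≥0} of positive reals satisfy A_0 = 0, α_{k+1} = 1/(2L_{k+1}) + √(1/(4L_{k+1}²) + A_k/L_{k+1}), A_{k+1} = A_k + α_{k+1}, L_0 ≤ 4M²/ε, and for each k ≥ 0 either L_{k+1} < 2A_{k+1}M²/(α_{k+1}ε) or L_{k+1} = L_k/2. Then α_k ≥ ε/(2M²) for all k ≥ 1, and consequently A_N ≥ εN/(2M²) for all N ≥ 1. -/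
/-- The larger root `a` of `l * x ^ 2 = b + x` satisfies this equation and `1 ≤ l * a`. -/
theorem quadratic_root_spec {l b a : ℝ} (hl : 0 < l) (hb : 0 ≤ b)
    (ha : a = 1 / (2 * l) + Real.sqrt (1 / (4 * l ^ 2) + b / l)) :
    0 < a ∧ l * a ^ 2 = b + a ∧ 1 ≤ l * a := by
  have hs : 0 ≤ 1 / (4 * l ^ 2) + b / l := by positivity
  have hsq := Real.sq_sqrt hs
  have hge : 1 / (2 * l) ≤ Real.sqrt (1 / (4 * l ^ 2) + b / l) := by
    apply Real.le_sqrt_of_sq_le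
    have h : (1 / (2 * l)) ^ 2 = 1 / (4 * l ^ 2) := by ring
    have : 0 ≤ b / l := by positivity
    linarith
  set r := Real.sqrt (1 / (4 * l ^ 2) + b / l)
  have hinv : 0 < 1 / (2 * l) := by positivity
  have hl_inv : l * (1 / (2 * l)) = 1 / 2 := by field_simp
  refine ⟨by linarith, ?_, ?_⟩
  · have hlr : l * r ^ 2 = 1 / (4 * l) + b := by
      rw [hsq]
      field_simp
    have hexp : l * a ^ 2 = l * (1 / (2 * l)) * (1 / (2 * l)) +
        2 * (l * (1 / (2 * l))) * r + l * r ^ 2 := by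
      rw [ha]
      ring
    rw [hexp, hl_inv, hlr, ha]
    ring
  · have := mul_le_mul_of_nonneg_left hge hl.le
    rw [ha, mul_add]
    linarith

/-- The positive root of `l * x ^ 2 = b + x` grows when `l` decreases and `b` increases. -/
theorem quadratic_root_mono {l l' b b' a a' : ℝ} (hl : 0 < l) (hll : l ≤ l') (hbb : b' ≤ b)
    (ha : 0 < a) (hroot : l * a ^ 2 = b + a) (hone : 1 ≤ l * a)
    (hroot' : l' * a' ^ 2 = b' + a') : a' ≤ a := by
  by_contra! hlt
  have h₁ : l * a < l' * a' :=
    (mul_lt_mul_of_pos_left hlt hl).trans_le (mul_le_mul_of_nonneg_right hll (ha.trans hlt).le)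
  have h₂ : a * (l * a - 1) < a' * (l' * a' - 1) := by
    nlinarith [mul_pos (ha.trans hlt) (sub_pos.2 h₁),
      mul_nonneg (sub_pos.2 hlt).le (sub_nonneg.2 hone)]
  nlinarith

/-- Lower bound on the UMST step-size accumulation: under the UMST recurrences
with `L_0 ≤ 4M²/ε` and the dichotomy `L_{k+1} < 2A_{k+1}M²/(α_{k+1}ε)` or
`L_{k+1} = L_k/2`, one has `α_k ≥ ε/(2M²)` for all `k ≥ 1` and hence
`A_N ≥ εN/(2M²)` for all `N ≥ 1`. -/
theorem umst_stepsize_lower_bound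
    (ε M : ℝ) (hε : 0 < ε) (hM : 0 < M)
    (L α A : ℕ → ℝ) (hLpos : ∀ k, 0 < L k)
    (hA0 : A 0 = 0)
    (hα : ∀ k : ℕ, α (k + 1) =
      1 / (2 * L (k + 1)) + Real.sqrt (1 / (4 * L (k + 1) ^ 2) + A k / L (k + 1)))
    (hA : ∀ k : ℕ, A (k + 1) = A k + α (k + 1))
    (hL0 : L 0 ≤ 4 * M ^ 2 / ε)
    (hdichotomy : ∀ k : ℕ,
      L (k + 1) < 2 * A (k + 1) * M ^ 2 / (α (k + 1) * ε) ∨ L (k + 1) = L k / 2) :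
    (∀ k : ℕ, 1 ≤ k → ε / (2 * M ^ 2) ≤ α k) ∧
    (∀ N : ℕ, 1 ≤ N → ε * N / (2 * M ^ 2) ≤ A N) := by
  have hAnn : ∀ k, 0 ≤ A k := by
    intro k
    induction k with
    | zero => exact hA0.ge
    | succ k ih =>
      have := (quadratic_root_spec (hLpos (k + 1)) ih (hα k)).1
      rw [hA]
      linarith
  have hspec k := quadratic_root_spec (hLpos (k + 1)) (hAnn k) (hα k)
  have hfirst : ∀ k, L (k + 1) < 2 * A (k + 1) * M ^ 2 / (α (k + 1) * ε) →
      ε / (2 * M ^ 2) ≤ α (k + 1) := by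
    intro k h
    obtain ⟨hpos, hroot, hone⟩ := hspec k
    rw [hA, ← hroot, lt_div_iff₀ (by positivity)] at h
    rw [div_le_iff₀ (by positivity)]
    have : 0 < L (k + 1) * α (k + 1) := by linarith
    nlinarith
  have hstep : ∀ k, ε / (2 * M ^ 2) ≤ α (k + 1) := by
    intro k
    induction k with
    | zero =>
      obtain ⟨hpos, -, hone⟩ := hspec 0
      rcases hdichotomy 0 with h | h
      · exact hfirst _ h
      · rw [le_div_iff₀ hε] at hL0
        rw [div_le_iff₀ (by positivity)]
        have hle : L (0 + 1) * ε ≤ 2 * M ^ 2 := by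
          rw [h]
          linarith
        nlinarith
    | succ k ih =>
      obtain ⟨hpos, hroot, hone⟩ := hspec (k + 1)
      rcases hdichotomy (k + 1) with h | h
      · exact hfirst _ h
      · obtain ⟨hpos', hroot', -⟩ := hspec k
        refine ih.trans (quadratic_root_mono (hLpos _) ?_ ?_ hpos hroot hone hroot')
        · linarith [hLpos (k + 1)]
        · linarith [hA k]
  have hsum : ∀ N : ℕ, ε * N / (2 * M ^ 2) ≤ A N := by
    intro N
    induction N with
    | zero => simp [hA0]
    | succ N ih =>
      have hsplit : ε * ((N + 1 : ℕ) : ℝ) / (2 * M ^ 2) =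
          ε * N / (2 * M ^ 2) + ε / (2 * M ^ 2) := by
        push_cast
        ring
      rw [hsplit, hA]
      exact add_le_add ih (hstep N)
  refine ⟨fun k hk => ?_, fun N _ => hsum N⟩
  · obtain ⟨k, rfl⟩ := Nat.exists_eq_add_of_le' hk
    exact hstep k
end

section
/- Theorem 3.6 (UMST complexity for the stable dynamics model): under the hypotheses of Lemma 3.5, assume additionally A_N ≥ εN/(2M²) for some M > 0. Then for every N ≥ 4(RM/ε)², Q(t^N) − Q(t*) ≤ ε. Moreover, if g = Θx' (x' ∈ X) satisfies ξ := 1 − max_e g_e/f̄_e > 0, f* = Θx* (x* ∈ X) is a primal optimum (f* ≤ f̄ and Ψ(f*) = −Q(t*)), and π(f̂^N) = f̂^N when η ≤ 0 and π(f̂^N) = (ξ f̂^N + η g)/(ξ + η) when η > 0, where η = max_e f̂^N_e/f̄_e − 1, then Q(t^N) + Ψ(π(f̂^N)) ≤ 2R²M²/(εN) + (⟨g − f*, t̄⟩/(ξ · min_e f̄_e)) · (8RM²/(εN) + √(4M²/N)) + ε/2. -/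
open Finset

theorem Finset.inf'_const_mul {ι : Type*} {s : Finset ι} (hs : s.Nonempty) {c : ℝ} (hc : 0 ≤ c)
    (f : ι → ℝ) : s.inf' hs (fun i => c * f i) = c * s.inf' hs f :=
  (Finset.apply_inf'_eq_inf'_comp (f := f) hs (fun r => c * r)
    (fun x y => mul_min_of_nonneg x y hc)).symm

/-- The cost of an admissible flow is at least the demand-weighted cost of the cheapest paths. -/
theorem sum_demand_mul_inf'_le_flow_cost {E P W : Type*} [Fintype E] [Fintype P] [Fintype W]
    [DecidableEq W] (a : P → E → ℝ) (wOD : P → W) (d : W → ℝ)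
    (hne : ∀ w : W, (univ.filter (fun p => wOD p = w)).Nonempty) (x : P → ℝ)
    (hx : ∀ p, 0 ≤ x p) (hxd : ∀ w, ∑ p ∈ univ.filter (fun p => wOD p = w), x p = d w)
    (t : E → ℝ) :
    ∑ w, d w * (univ.filter (fun p => wOD p = w)).inf' (hne w) (fun p => ∑ e, t e * a p e)
      ≤ ∑ e, t e * ∑ p, a p e * x p := by
  have hswap : ∑ e, t e * ∑ p, a p e * x p = ∑ p, x p * ∑ e, t e * a p e := by
    simp only [mul_sum]
    rw [sum_comm]
    exact sum_congr rfl fun p _ => sum_congr rfl fun e _ => by ring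
  rw [hswap, ← sum_fiberwise univ wOD (fun p => x p * ∑ e, t e * a p e)]
  refine sum_le_sum fun w _ => ?_
  rw [← hxd w, sum_mul]
  exact sum_le_sum fun p hp => mul_le_mul_of_nonneg_left (inf'_le _ hp) (hx p)

/-- Euler's identity for subgradients of a positively homogeneous function. -/
theorem eq_sum_mul_of_subgradient_of_homogeneous {E : Type*} [Fintype E] {Φ : (E → ℝ) → ℝ}
    (hΦ : ∀ (c : ℝ) (t : E → ℝ), 0 ≤ c → Φ (fun e => c * t e) = c * Φ t) {y g : E → ℝ}
    (hg : ∀ s : E → ℝ, Φ y + ∑ e, g e * (s e - y e) ≤ Φ s) : Φ y = ∑ e, g e * y e := by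
  have h0 := hg (fun e => 0 * y e)
  have h2 := hg (fun e => 2 * y e)
  rw [hΦ 0 y le_rfl] at h0
  rw [hΦ 2 y zero_le_two] at h2
  have e0 : ∑ e, g e * (0 * y e - y e) = -∑ e, g e * y e := by
    rw [← sum_neg_distrib]
    exact sum_congr rfl fun e _ => by ring
  have e2 : ∑ e, g e * (2 * y e - y e) = ∑ e, g e * y e :=
    sum_congr rfl fun e _ => by ring
  linarith

theorem le_two_mul_div_add_sqrt_of_quadratic_le {A R c ε : ℝ} (hA : 0 < A) (hε : 0 ≤ ε)
    (hR : 0 ≤ R) (h : A / 2 * c ^ 2 ≤ ε / 2 + R * c) : c ≤ 2 * R / A + √(ε / A) := by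
  by_contra! hc
  have hs0 := Real.sqrt_nonneg (ε / A)
  have hs : A * √(ε / A) ^ 2 = ε := by
    rw [Real.sq_sqrt (by positivity)]
    field_simp
  set s := √(ε / A)
  have hRA : 0 ≤ 2 * R / A := by positivity
  have hsc : s < c := by linarith
  have hcs : 2 * R + A * s < A * c := by
    have := mul_lt_mul_of_pos_left hc hA
    have e1 : A * (2 * R / A + s) = 2 * R + A * s := by field_simp
    linarith
  have h1 : (2 * R + A * s) * c < A * c * c :=
    mul_lt_mul_of_pos_right hcs (by linarith)
  have h2 : A * s * s ≤ A * s * c := mul_le_mul_of_nonneg_left hsc.le (by positivity)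
  nlinarith

set_option maxHeartbeats 1000000 in
/-- Theorem 3.6 (UMST complexity for the stable dynamics model): under the
hypotheses of Lemma 3.5 with `A_N ≥ εN/(2M²)`, for every `N ≥ 4(RM/ε)²` one has
`Q(t^N) − Q(t*) ≤ ε`; moreover, given admissible flows `g = Θx'` with
`ξ := 1 − max_e g_e/f̄_e > 0`, a primal optimum `f* = Θx*` and the reconstructed
flows `π(f̂^N)`, one has
`Q(t^N) + Ψ(π(f̂^N)) ≤ 2R²M²/(εN) + (⟨g − f*, t̄⟩/(ξ·min_e f̄_e))·(8RM²/(εN) + √(4M²/N)) + ε/2`. -/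
theorem umst_stable_dynamics_complexity
    (E P W : Type) [Fintype E] [Fintype P] [Fintype W] [DecidableEq W] [Nonempty E]
    (a : P → E → ℝ) (ha : ∀ p e, a p e = 0 ∨ a p e = 1)
    (wOD : P → W) (d : W → ℝ) (hd : ∀ w, 0 < d w)
    (hne : ∀ w : W, (univ.filter (fun p => wOD p = w)).Nonempty)
    (Φ : (E → ℝ) → ℝ)
    (hΦ : ∀ t : E → ℝ, Φ t = -∑ w, d w *
        (univ.filter (fun p => wOD p = w)).inf' (hne w) (fun p => ∑ e, t e * a p e))
    (tbar fbar : E → ℝ) (htbar : ∀ e, 0 < tbar e) (hfbar : ∀ e, 0 < fbar e)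
    (Ψ : (E → ℝ) → ℝ) (hΨ : ∀ f : E → ℝ, Ψ f = ∑ e, tbar e * f e)
    (Q : (E → ℝ) → ℝ) (hQ : ∀ t : E → ℝ, Q t = Φ t + ∑ e, (t e - tbar e) * fbar e)
    (ε : ℝ) (hε : 0 < ε)
    (N : ℕ) (hN : 0 < N)
    (tN : E → ℝ) (htN : ∀ e, tbar e ≤ tN e)
    (yv : ℕ → E → ℝ) (hyv : ∀ k, 1 ≤ k → k ≤ N → ∀ e, tbar e ≤ yv k e)
    (α : ℕ → ℝ) (hα : ∀ k, 1 ≤ k → k ≤ N → 0 < α k)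
    (A : ℝ) (hA : A = ∑ k ∈ range N, α (k + 1))
    (gv : ℕ → E → ℝ)
    (hgsub : ∀ k, 1 ≤ k → k ≤ N →
      ∀ s : E → ℝ, Φ (yv k) + ∑ e, gv k e * (s e - yv k e) ≤ Φ s)
    (xv : ℕ → P → ℝ)
    (hxv0 : ∀ k, 1 ≤ k → k ≤ N → ∀ p, 0 ≤ xv k p)
    (hxvd : ∀ k, 1 ≤ k → k ≤ N →
      ∀ w, ∑ p ∈ univ.filter (fun p => wOD p = w), xv k p = d w)
    (hgx : ∀ k, 1 ≤ k → k ≤ N → ∀ e, gv k e = -(∑ p, a p e * xv k p))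
    (fhat : E → ℝ)
    (hfhat : ∀ e, fhat e = -((1 / A) * ∑ k ∈ range N, α (k + 1) * gv (k + 1) e))
    (hUMST : ∀ t : E → ℝ, (∀ e, tbar e ≤ t e) →
      Q tN ≤ (1 / A) * ∑ k ∈ range N, α (k + 1) *
          (Φ (yv (k + 1)) + ∑ e, gv (k + 1) e * (t e - yv (k + 1) e))
        + ∑ e, (t e - tbar e) * fbar e + (∑ e, (t e - tbar e) ^ 2) / (2 * A) + ε / 2)
    (tstar : E → ℝ) (htstar : ∀ e, tbar e ≤ tstar e)
    (htstar_min : ∀ t : E → ℝ, (∀ e, tbar e ≤ t e) → Q tstar ≤ Q t)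
    (R : ℝ) (hR : R = Real.sqrt (∑ e, (tstar e - tbar e) ^ 2))
    (M : ℝ) (hM : 0 < M)
    (hAlb : ε * N / (2 * M ^ 2) ≤ A)
    -- admissible flows g = Θx'
    (x' : P → ℝ) (hx'0 : ∀ p, 0 ≤ x' p)
    (hx'd : ∀ w, ∑ p ∈ univ.filter (fun p => wOD p = w), x' p = d w)
    (g : E → ℝ) (hg : ∀ e, g e = ∑ p, a p e * x' p)
    (ξ : ℝ) (hξ : ξ = 1 - univ.sup' univ_nonempty (fun e => g e / fbar e))
    (hξpos : 0 < ξ)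
    -- primal optimum f* = Θx*
    (xs : P → ℝ) (hxs0 : ∀ p, 0 ≤ xs p)
    (hxsd : ∀ w, ∑ p ∈ univ.filter (fun p => wOD p = w), xs p = d w)
    (fstar : E → ℝ) (hfstar : ∀ e, fstar e = ∑ p, a p e * xs p)
    (hfstar_cap : ∀ e, fstar e ≤ fbar e)
    (hfstar_opt : Ψ fstar = -Q tstar)
    -- reconstruction π(f̂^N)
    (η : ℝ) (hη : η = univ.sup' univ_nonempty (fun e => fhat e / fbar e) - 1)
    (πf : E → ℝ)
    (hπf : πf = if η ≤ 0 then fhat else fun e => (ξ * fhat e + η * g e) / (ξ + η)) :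
    (4 * (R * M / ε) ^ 2 ≤ (N : ℝ) → Q tN - Q tstar ≤ ε) ∧
    (Q tN + Ψ πf
      ≤ 2 * R ^ 2 * M ^ 2 / (ε * N)
        + ((∑ e, (g e - fstar e) * tbar e) / (ξ * univ.inf' univ_nonempty fbar)) *
            (8 * R * M ^ 2 / (ε * N) + Real.sqrt (4 * M ^ 2 / N))
        + ε / 2) := by
  have hNpos : (0 : ℝ) < N := Nat.cast_pos.mpr hN
  have hApos : 0 < A := lt_of_lt_of_le (by positivity) hAlb
  have hAinv : 1 / A * A = 1 := by field_simp
  have hR0 : 0 ≤ R := hR ▸ Real.sqrt_nonneg _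
  have hRsq : R ^ 2 = ∑ e, (tstar e - tbar e) ^ 2 := by
    rw [hR, Real.sq_sqrt (sum_nonneg fun e _ => sq_nonneg _)]
  have hRA : R ^ 2 / (2 * A) ≤ R ^ 2 * M ^ 2 / (ε * N) := by
    rw [div_le_div_iff₀ (by positivity) (by positivity)]
    have h1 : ε * N ≤ A * (2 * M ^ 2) := (div_le_iff₀ (by positivity)).mp hAlb
    nlinarith [mul_le_mul_of_nonneg_left h1 (sq_nonneg R)]
  have hk : ∀ k ∈ range N, 1 ≤ k + 1 ∧ k + 1 ≤ N := fun k hk => by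
    have := mem_range.mp hk
    omega
  have hhom : ∀ (c : ℝ) (t : E → ℝ), 0 ≤ c → Φ (fun e => c * t e) = c * Φ t := by
    intro c t hc
    rw [hΦ, hΦ, mul_neg, mul_sum]
    refine congrArg Neg.neg (sum_congr rfl fun w _ => ?_)
    have hcost : (fun p => ∑ e, c * t e * a p e) = fun p => c * ∑ e, t e * a p e := by
      funext p
      rw [mul_sum]
      exact sum_congr rfl fun e _ => mul_assoc _ _ _
    rw [hcost, inf'_const_mul (hne w) hc]
    ring
  have heuler : ∀ k ∈ range N, Φ (yv (k + 1)) = ∑ e, gv (k + 1) e * yv (k + 1) e :=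
    fun k h => eq_sum_mul_of_subgradient_of_homogeneous hhom (hgsub _ (hk k h).1 (hk k h).2)
  have havg_le : ∀ t : E → ℝ, (1 / A) * ∑ k ∈ range N, α (k + 1) *
      (Φ (yv (k + 1)) + ∑ e, gv (k + 1) e * (t e - yv (k + 1) e)) ≤ Φ t := by
    intro t
    calc _ ≤ (1 / A) * ∑ k ∈ range N, α (k + 1) * Φ t := by
          refine mul_le_mul_of_nonneg_left (sum_le_sum fun k h => ?_) (by positivity)
          exact mul_le_mul_of_nonneg_left (hgsub _ (hk k h).1 (hk k h).2 t)
            (hα _ (hk k h).1 (hk k h).2).le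
      _ = Φ t := by rw [← sum_mul, ← hA, ← mul_assoc, hAinv, one_mul]
  have havg_eq : ∀ t : E → ℝ, (1 / A) * ∑ k ∈ range N, α (k + 1) *
      (Φ (yv (k + 1)) + ∑ e, gv (k + 1) e * (t e - yv (k + 1) e)) = -∑ e, t e * fhat e := by
    intro t
    have hlin : ∑ k ∈ range N, α (k + 1) *
        (Φ (yv (k + 1)) + ∑ e, gv (k + 1) e * (t e - yv (k + 1) e))
        = ∑ k ∈ range N, ∑ e, t e * (α (k + 1) * gv (k + 1) e) := by
      refine sum_congr rfl fun k h => ?_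
      rw [heuler k h, ← sum_add_distrib, mul_sum]
      exact sum_congr rfl fun e _ => by ring
    rw [hlin, sum_comm, mul_sum, ← sum_neg_distrib]
    refine sum_congr rfl fun e _ => ?_
    rw [hfhat, ← mul_sum]
    ring
  have hdual : ∀ f : E → ℝ, -∑ e, tstar e * f e ≤ Φ tstar →
      -Ψ f - ∑ e, (tstar e - tbar e) * (f e - fbar e) ≤ Q tstar := by
    intro f hf
    have hsplit : -Ψ f - ∑ e, (tstar e - tbar e) * (f e - fbar e)
        = -∑ e, tstar e * f e + ∑ e, (tstar e - tbar e) * fbar e := by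
      rw [hΨ, ← sum_neg_distrib, ← sum_neg_distrib, ← sum_sub_distrib, ← sum_add_distrib]
      exact sum_congr rfl fun e _ => by ring
    rw [hsplit, hQ]
    linarith
  constructor
  · intro hNlb
    have h1 := hUMST tstar htstar
    have h2 := havg_le tstar
    have h3 := hQ tstar
    rw [← hRsq] at h1
    have h4 : R ^ 2 * M ^ 2 / (ε * N) ≤ ε / 2 := by
      rw [div_le_iff₀ (by positivity)]
      have e1 : 4 * (R * M / ε) ^ 2 * ε ^ 2 = 4 * (R ^ 2 * M ^ 2) := by field_simp
      have h5 := mul_le_mul_of_nonneg_right hNlb (sq_nonneg ε)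
      nlinarith [mul_nonneg (sq_nonneg R) (sq_nonneg M)]
    linarith
  set c : E → ℝ := fun e => max (fhat e - fbar e) 0 with hc
  have hc0 : ∀ e, 0 ≤ c e := fun e => le_max_right _ _
  set C : ℝ := √(∑ e, c e ^ 2) with hC
  have hC0 : 0 ≤ C := Real.sqrt_nonneg _
  have hCsq : C ^ 2 = ∑ e, c e ^ 2 := Real.sq_sqrt (sum_nonneg fun e _ => sq_nonneg _)
  have hgap : Q tN + Ψ fhat ≤ ε / 2 - A / 2 * C ^ 2 := by
    have h1 := hUMST (fun e => tbar e + A * c e)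
      (fun e => le_add_of_nonneg_right (mul_nonneg hApos.le (hc0 e)))
    rw [havg_eq] at h1
    have h2 : -∑ e, (tbar e + A * c e) * fhat e + ∑ e, (tbar e + A * c e - tbar e) * fbar e
        + (∑ e, (tbar e + A * c e - tbar e) ^ 2) / (2 * A) = -Ψ fhat - A / 2 * C ^ 2 := by
      rw [hCsq, hΨ, sum_div, mul_sum, ← sum_neg_distrib, ← sum_neg_distrib, ← sum_add_distrib,
        ← sum_add_distrib, ← sum_sub_distrib]
      refine sum_congr rfl fun e _ => ?_
      have hcc : (fhat e - fbar e) * c e = c e ^ 2 := by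
        rcases le_total (fhat e - fbar e) 0 with h | h
        · simp [hc, max_eq_right h]
        · simp only [hc, max_eq_left h]
          ring
      have hdiv : (tbar e + A * c e - tbar e) ^ 2 / (2 * A) = A / 2 * c e ^ 2 := by
        field_simp
        ring
      rw [hdiv]
      linear_combination (-A) * hcc
    linarith
  have hlower : -Ψ fhat - R * C ≤ Q tstar := by
    have h1 := hdual fhat ((havg_eq tstar) ▸ havg_le tstar)
    have h2 : ∑ e, (tstar e - tbar e) * (fhat e - fbar e) ≤ ∑ e, (tstar e - tbar e) * c e :=
      sum_le_sum fun e _ => mul_le_mul_of_nonneg_left (le_max_left _ _)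
        (sub_nonneg.mpr (htstar e))
    have h3 : ∑ e, (tstar e - tbar e) * c e ≤ R * C := by
      rw [hR]
      exact Real.sum_mul_le_sqrt_mul_sqrt _ _ _
    linarith
  have hQmin : Q tstar ≤ Q tN := htstar_min tN htN
  have hCle : C ≤ 2 * R / A + √(ε / A) :=
    le_two_mul_div_add_sqrt_of_quadratic_le hApos hε.le hR0 (by linarith)
  have hinvA : 1 / A ≤ 2 * M ^ 2 / (ε * N) := by
    rw [div_le_div_iff₀ hApos (by positivity)]
    have h1 : ε * N ≤ A * (2 * M ^ 2) := (div_le_iff₀ (by positivity)).mp hAlb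
    linarith
  have hCbound : C ≤ 8 * R * M ^ 2 / (ε * N) + √(4 * M ^ 2 / N) := by
    have h1 : 2 * R / A ≤ 8 * R * M ^ 2 / (ε * N) := by
      have h2 := mul_le_mul_of_nonneg_left hinvA (by positivity : 0 ≤ 2 * R)
      have e1 : 2 * R * (1 / A) = 2 * R / A := by ring
      have e2 : 8 * R * M ^ 2 / (ε * N) = 2 * (2 * R * (2 * M ^ 2 / (ε * N))) := by ring
      have : 0 ≤ 2 * R * (2 * M ^ 2 / (ε * N)) := by positivity
      linarith
    have h3 : √(ε / A) ≤ √(4 * M ^ 2 / N) := by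
      refine Real.sqrt_le_sqrt ?_
      have h4 := mul_le_mul_of_nonneg_left hinvA hε.le
      have e1 : ε * (1 / A) = ε / A := by ring
      have e2 : 4 * M ^ 2 / N = 2 * (ε * (2 * M ^ 2 / (ε * N))) := by
        field_simp
        ring
      have : 0 ≤ ε * (2 * M ^ 2 / (ε * N)) := by positivity
      linarith
    linarith
  have hgcap : ∀ e, g e ≤ fbar e := by
    intro e
    have h1 : g e / fbar e ≤ univ.sup' univ_nonempty (fun e => g e / fbar e) :=
      le_sup' (fun e => g e / fbar e) (mem_univ e)
    have h2 : g e / fbar e ≤ 1 := by linarith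
    exact (div_le_one (hfbar e)).mp h2
  have hgfstar : Ψ fstar ≤ Ψ g := by
    have h1 : -∑ e, tstar e * g e ≤ Φ tstar := by
      rw [hΦ, funext hg]
      exact neg_le_neg (sum_demand_mul_inf'_le_flow_cost a wOD d hne x' hx'0 hx'd tstar)
    have h2 := hdual g h1
    have h3 : ∑ e, (tstar e - tbar e) * (g e - fbar e) ≤ 0 :=
      sum_nonpos fun e _ => mul_nonpos_of_nonneg_of_nonpos (sub_nonneg.mpr (htstar e))
        (sub_nonpos.mpr (hgcap e))
    linarith
  have hG : ∑ e, (g e - fstar e) * tbar e = Ψ g - Ψ fstar := by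
    rw [hΨ, hΨ, ← sum_sub_distrib]
    exact sum_congr rfl fun e _ => by ring
  set m := univ.inf' univ_nonempty fbar with hm
  have hmpos : 0 < m := (lt_inf'_iff _).mpr fun e _ => hfbar e
  have hslack : (Ψ g - Ψ fstar) / (ξ * m) * C
      ≤ (Ψ g - Ψ fstar) / (ξ * m) * (8 * R * M ^ 2 / (ε * N) + √(4 * M ^ 2 / N)) :=
    mul_le_mul_of_nonneg_left hCbound (div_nonneg (sub_nonneg.mpr hgfstar) (by positivity))
  have hterm : 0 ≤ R ^ 2 * M ^ 2 / (ε * N) := by positivity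
  have hterm2 : 2 * R ^ 2 * M ^ 2 / (ε * N) = 2 * (R ^ 2 * M ^ 2 / (ε * N)) := by ring
  have hACsq : 0 ≤ A / 2 * C ^ 2 := by positivity
  rw [hG, hterm2]
  by_cases hη0 : η ≤ 0
  · rw [hπf, if_pos hη0]
    have : 0 ≤ (Ψ g - Ψ fstar) / (ξ * m) * C :=
      mul_nonneg (div_nonneg (sub_nonneg.mpr hgfstar) (by positivity)) hC0
    linarith
  · have hηpos : 0 < η := not_le.mp hη0
    rw [hπf, if_neg hη0]
    have hmη : η * m ≤ C := by
      obtain ⟨e, -, he⟩ := exists_mem_eq_sup' univ_nonempty (fun e => fhat e / fbar e)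
      have hηe : η * fbar e = fhat e - fbar e := by
        have := (hfbar e).ne'
        rw [hη, he]
        field_simp
      have hme : m ≤ fbar e := inf'_le _ (mem_univ e)
      calc η * m ≤ η * fbar e := mul_le_mul_of_nonneg_left hme hηpos.le
        _ ≤ c e := hηe ▸ le_max_left _ _
        _ ≤ C := Real.le_sqrt_of_sq_le
          (single_le_sum (f := fun e => c e ^ 2) (fun e _ => sq_nonneg _) (mem_univ e))
    have hsum : 0 < ξ + η := by positivity
    have hΨπ : Ψ (fun e => (ξ * fhat e + η * g e) / (ξ + η))
        = Ψ fhat + η / (ξ + η) * (Ψ g - Ψ fhat) := by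
      rw [hΨ, hΨ, hΨ, ← sum_sub_distrib, mul_sum, ← sum_add_distrib]
      refine sum_congr rfl fun e _ => ?_
      field_simp
      ring
    set θ := η / (ξ + η) with hθ
    have hθ0 : 0 ≤ θ := by positivity
    have hθ1 : θ ≤ 1 := (div_le_one hsum).mpr (by linarith)
    have hθC : θ ≤ C / (ξ * m) := by
      rw [hθ, div_le_div_iff₀ hsum (by positivity)]
      nlinarith [mul_le_mul_of_nonneg_left hmη hξpos.le, mul_nonneg hC0 hηpos.le]
    have h1 : θ * (Ψ g - Ψ fhat) ≤ θ * (Ψ g - Ψ fstar + R * C) :=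
      mul_le_mul_of_nonneg_left (by linarith) hθ0
    have h2 : θ * (R * C) ≤ R * C := mul_le_of_le_one_left (mul_nonneg hR0 hC0) hθ1
    have h3 : θ * (Ψ g - Ψ fstar) ≤ (Ψ g - Ψ fstar) / (ξ * m) * C := by
      have h4 := mul_le_mul_of_nonneg_right hθC (sub_nonneg.mpr hgfstar)
      calc _ ≤ _ := h4
        _ = _ := by ring
    have h5 : R * C - A / 2 * C ^ 2 ≤ R ^ 2 / (2 * A) := by
      rw [le_div_iff₀ (by positivity)]
      nlinarith [sq_nonneg (R - A * C)]
    rw [hΨπ]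
    linarith
end

section
/- Theorem 3.7 (UMST complexity for the Beckmann model): assume points t^N, y^1, …, y^N ≥ t̄, positive weights α_k with A_N = ∑_{k=1}^N α_k, and subgradients g^k of Φ at y^k with −g^k = Θx^k for some x^k ∈ X satisfy Q(t^N) ≤ min_{t ≥ t̄} { (1/A_N) ∑_{k=1}^N α_k [Φ(y^k) + ⟨g^k, t − y^k⟩] + ∑_e σ_e*(t_e) + ‖t − t̄‖₂²/(2A_N) } + ε/2, set f̂^N = −(1/A_N) ∑_{k=1}^N α_k g^k, and assume A_N ≥ εN/(2M²) for some M > 0 and f̂^N_e ≤ ∑_w d_w for all e. Let t* minimize Q over {t ≥ t̄}, R = ‖t* − t̄‖₂, and R̃² = ρ² ∑_e (t̄_e²/f̄_e^{2/μ}) (∑_w d_w)^{2/μ}. Then for every N ≥ 4(RM/ε)², Q(t^N) − Q(t*) ≤ ε; and for every N ≥ 4(R̃M/ε)², Q(t^N) + Ψ(f̂^N) ≤ ε. -/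
open Finset

/-- The integral of the travel time `t̄ (1 + ρ (z / f̄) ^ r)` from `0` to `f`. -/
lemma integral_travelTime {t b ρ r f : ℝ} (hb : 0 < b) (hr : 0 < r) (hf : 0 ≤ f) :
    ∫ z in (0 : ℝ)..f, t * (1 + ρ * (z / b) ^ r) =
      t * f + t * ρ * f * (f / b) ^ r / (r + 1) := by
  have hcont : Continuous fun z : ℝ => ρ * (z / b) ^ r :=
    continuous_const.mul ((continuous_id.div_const b).rpow_const fun _ => Or.inr hr.le)
  have hpow : (f / b) ^ (r + 1) = (f / b) ^ r * (f / b) := by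
    rw [Real.rpow_add_one' (by positivity) (by positivity)]
  rw [intervalIntegral.integral_const_mul,
    intervalIntegral.integral_add (by simp) (hcont.intervalIntegrable _ _),
    intervalIntegral.integral_const_mul,
    intervalIntegral.integral_comp_div (fun z : ℝ => z ^ r) hb.ne',
    integral_rpow (Or.inl (by linarith)), zero_div, Real.zero_rpow (by positivity), hpow]
  simp only [intervalIntegral.integral_const, smul_eq_mul]
  field_simp
  ring

/-- Equality in the Fenchel–Young inequality for the Beckmann cost of one link. -/
lemma beckmann_conjugate_travelTime {t b ρ μ f : ℝ} (ht : 0 < t) (hb : 0 < b) (hρ : 0 < ρ)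
    (hμ : 0 < μ) (hf : 0 ≤ f) :
    b * ((t * (1 + ρ * (f / b) ^ (1 / μ)) - t) / (t * ρ)) ^ μ *
        (t * (1 + ρ * (f / b) ^ (1 / μ)) - t) / (1 + μ) +
      ∫ z in (0 : ℝ)..f, t * (1 + ρ * (z / b) ^ (1 / μ)) =
      f * (t * (1 + ρ * (f / b) ^ (1 / μ))) := by
  have hbase : (t * (1 + ρ * (f / b) ^ (1 / μ)) - t) / (t * ρ) = (f / b) ^ (1 / μ) := by
    field_simp
    ring
  rw [integral_travelTime hb (by positivity) hf, hbase,
    ← Real.rpow_mul (by positivity), one_div_mul_cancel hμ.ne', Real.rpow_one]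
  field_simp
  ring

/-- The squared travel-time increment is monotone in the flow. -/
lemma sq_travelTime_sub_le {t b ρ μ f D : ℝ} (hb : 0 < b) (hμ : 0 < μ) (hf : 0 ≤ f)
    (hfD : f ≤ D) :
    (t * (1 + ρ * (f / b) ^ (1 / μ)) - t) ^ 2 ≤
      ρ ^ 2 * (t ^ 2 / b ^ (2 / μ) * D ^ (2 / μ)) := by
  have hsq : ((f / b) ^ (1 / μ)) ^ 2 = f ^ (2 / μ) / b ^ (2 / μ) := by
    rw [← Real.rpow_natCast, ← Real.rpow_mul (by positivity), Real.div_rpow hf hb.le]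
    congr 2 <;> push_cast <;> ring
  have hmono : f ^ (2 / μ) ≤ D ^ (2 / μ) := Real.rpow_le_rpow hf hfD (by positivity)
  calc (t * (1 + ρ * (f / b) ^ (1 / μ)) - t) ^ 2
      = ρ ^ 2 * (t ^ 2 * ((f / b) ^ (1 / μ)) ^ 2) := by ring
    _ = ρ ^ 2 * (t ^ 2 / b ^ (2 / μ) * f ^ (2 / μ)) := by rw [hsq]; ring
    _ ≤ ρ ^ 2 * (t ^ 2 / b ^ (2 / μ) * D ^ (2 / μ)) := by gcongr

/-- The regularization term is at most `ε / 2` once enough iterations are made. -/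
lemma div_two_mul_le_of_iterations {A M N ε r S : ℝ} (hA : 0 < A) (hM : 0 < M) (hε : 0 < ε)
    (hAlb : ε * N / (2 * M ^ 2) ≤ A) (hS : S ≤ r ^ 2) (hN : 4 * (r * M / ε) ^ 2 ≤ N) :
    S / (2 * A) ≤ ε / 2 := by
  have h : 2 * r ^ 2 / ε ≤ A := by
    calc 2 * r ^ 2 / ε = ε * (4 * (r * M / ε) ^ 2) / (2 * M ^ 2) := by
          field_simp
          ring
      _ ≤ ε * N / (2 * M ^ 2) := by gcongr
      _ ≤ A := hAlb
  rw [div_le_iff₀ hε] at h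
  rw [div_le_iff₀ (by positivity)]
  nlinarith [sq_nonneg r]

/-- A weighted average of numbers bounded by `c` is bounded by `c`. -/
lemma weighted_average_le {ι : Type*} {s : Finset ι} {w v : ι → ℝ} {A c : ℝ}
    (hA : A = ∑ i ∈ s, w i) (hApos : 0 < A) (hw : ∀ i ∈ s, 0 ≤ w i) (hv : ∀ i ∈ s, v i ≤ c) :
    (1 / A) * ∑ i ∈ s, w i * v i ≤ c := by
  have h : ∑ i ∈ s, w i * v i ≤ A * c := by
    rw [hA, Finset.sum_mul]
    exact Finset.sum_le_sum fun i hi => mul_le_mul_of_nonneg_left (hv i hi) (hw i hi)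
  rw [one_div, inv_mul_le_iff₀ hApos]
  exact h

/-- Theorem 3.7 (UMST complexity for the Beckmann model): under the UMST
inequality with composite term `∑_e σ_e*(t_e)`, with `A_N ≥ εN/(2M²)` and
`f̂^N_e ≤ ∑_w d_w`, for every `N ≥ 4(RM/ε)²` one has `Q(t^N) − Q(t*) ≤ ε`, and
for every `N ≥ 4(R̃M/ε)²` one has `Q(t^N) + Ψ(f̂^N) ≤ ε`, where
`R̃² = ρ² ∑_e (t̄_e²/f̄_e^{2/μ}) (∑_w d_w)^{2/μ}`. -/
theorem umst_beckmann_complexity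
    (E P W : Type) [Fintype E] [Fintype P] [Fintype W] [DecidableEq W]
    (a : P → E → ℝ) (ha : ∀ p e, a p e = 0 ∨ a p e = 1)
    (wOD : P → W) (d : W → ℝ) (hd : ∀ w, 0 < d w)
    (hne : ∀ w : W, (univ.filter (fun p => wOD p = w)).Nonempty)
    (Φ : (E → ℝ) → ℝ)
    (hΦ : ∀ t : E → ℝ, Φ t = -∑ w, d w *
        (univ.filter (fun p => wOD p = w)).inf' (hne w) (fun p => ∑ e, t e * a p e))
    (tbar fbar : E → ℝ) (htbar : ∀ e, 0 < tbar e) (hfbar : ∀ e, 0 < fbar e)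
    (ρ μ : ℝ) (hρ : 0 < ρ) (hμ0 : 0 < μ) (hμ1 : μ ≤ 1)
    (τ : E → ℝ → ℝ)
    (hτ : ∀ e (x : ℝ), τ e x = tbar e * (1 + ρ * (x / fbar e) ^ (1 / μ)))
    (σ : E → ℝ → ℝ) (hσ : ∀ e (x : ℝ), σ e x = ∫ z in (0:ℝ)..x, τ e z)
    (Ψ : (E → ℝ) → ℝ) (hΨ : ∀ f : E → ℝ, Ψ f = ∑ e, σ e (f e))
    (σs : E → ℝ → ℝ)
    (hσs : ∀ e (te : ℝ), σs e te =
      fbar e * ((te - tbar e) / (tbar e * ρ)) ^ μ * (te - tbar e) / (1 + μ))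
    (Q : (E → ℝ) → ℝ) (hQ : ∀ t : E → ℝ, Q t = Φ t + ∑ e, σs e (t e))
    (ε : ℝ) (hε : 0 < ε)
    (N : ℕ) (hN : 0 < N)
    (tN : E → ℝ) (htN : ∀ e, tbar e ≤ tN e)
    (yv : ℕ → E → ℝ) (hyv : ∀ k, 1 ≤ k → k ≤ N → ∀ e, tbar e ≤ yv k e)
    (α : ℕ → ℝ) (hα : ∀ k, 1 ≤ k → k ≤ N → 0 < α k)
    (A : ℝ) (hA : A = ∑ k ∈ range N, α (k + 1))
    (gv : ℕ → E → ℝ)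
    (hgsub : ∀ k, 1 ≤ k → k ≤ N →
      ∀ s : E → ℝ, Φ (yv k) + ∑ e, gv k e * (s e - yv k e) ≤ Φ s)
    (xv : ℕ → P → ℝ)
    (hxv0 : ∀ k, 1 ≤ k → k ≤ N → ∀ p, 0 ≤ xv k p)
    (hxvd : ∀ k, 1 ≤ k → k ≤ N →
      ∀ w, ∑ p ∈ univ.filter (fun p => wOD p = w), xv k p = d w)
    (hgx : ∀ k, 1 ≤ k → k ≤ N → ∀ e, gv k e = -(∑ p, a p e * xv k p))
    (fhat : E → ℝ)
    (hfhat : ∀ e, fhat e = -((1 / A) * ∑ k ∈ range N, α (k + 1) * gv (k + 1) e))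
    (hUMST : ∀ t : E → ℝ, (∀ e, tbar e ≤ t e) →
      Q tN ≤ (1 / A) * ∑ k ∈ range N, α (k + 1) *
          (Φ (yv (k + 1)) + ∑ e, gv (k + 1) e * (t e - yv (k + 1) e))
        + ∑ e, σs e (t e) + (∑ e, (t e - tbar e) ^ 2) / (2 * A) + ε / 2)
    (tstar : E → ℝ) (htstar : ∀ e, tbar e ≤ tstar e)
    (htstar_min : ∀ t : E → ℝ, (∀ e, tbar e ≤ t e) → Q tstar ≤ Q t)
    (R : ℝ) (hR : R = Real.sqrt (∑ e, (tstar e - tbar e) ^ 2))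
    (M : ℝ) (hM : 0 < M)
    (hAlb : ε * N / (2 * M ^ 2) ≤ A)
    (hfhatD : ∀ e, fhat e ≤ ∑ w, d w)
    (Rt : ℝ)
    (hRt : Rt = Real.sqrt (ρ ^ 2 *
      ∑ e, tbar e ^ 2 / fbar e ^ (2 / μ) * (∑ w, d w) ^ (2 / μ))) :
    (4 * (R * M / ε) ^ 2 ≤ (N : ℝ) → Q tN - Q tstar ≤ ε) ∧
    (4 * (Rt * M / ε) ^ 2 ≤ (N : ℝ) → Q tN + Ψ fhat ≤ ε) := by
  have hk : ∀ k ∈ range N, 1 ≤ k + 1 ∧ k + 1 ≤ N := fun k h => by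
    rw [mem_range] at h
    omega
  have hα' : ∀ k ∈ range N, 0 < α (k + 1) := fun k h => hα _ (hk k h).1 (hk k h).2
  have hApos : 0 < A := hA ▸ sum_pos hα' (nonempty_range_iff.mpr hN.ne')
  refine ⟨fun hNR => ?_, fun hNR => ?_⟩
  · have hmodel : (1 / A) * ∑ k ∈ range N, α (k + 1) *
        (Φ (yv (k + 1)) + ∑ e, gv (k + 1) e * (tstar e - yv (k + 1) e)) ≤ Φ tstar :=
      weighted_average_le hA hApos (fun k h => (hα' k h).le)
        fun k h => hgsub _ (hk k h).1 (hk k h).2 tstar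
    have hreg : (∑ e, (tstar e - tbar e) ^ 2) / (2 * A) ≤ ε / 2 := by
      refine div_two_mul_le_of_iterations hApos hM hε hAlb ?_ hNR
      rw [hR, Real.sq_sqrt (sum_nonneg fun e _ => sq_nonneg _)]
    linarith [hUMST tstar htstar, hQ tstar]
  · have hf0 : ∀ e, 0 ≤ fhat e := fun e => by
      rw [hfhat, ← mul_neg, ← sum_neg_distrib]
      refine mul_nonneg (by positivity) (sum_nonneg fun k h => ?_)
      rw [hgx _ (hk k h).1 (hk k h).2, mul_neg, neg_neg]
      refine mul_nonneg (hα' k h).le (sum_nonneg fun p _ => mul_nonneg ?_ ?_)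
      · rcases ha p e with h0 | h1 <;> simp [*]
      · exact hxv0 _ (hk k h).1 (hk k h).2 p
    have hD : 0 ≤ ∑ w, d w := sum_nonneg fun w _ => (hd w).le
    have hΦ0 : Φ 0 = 0 := by simp [hΦ]
    set t : E → ℝ := fun e => τ e (fhat e) with ht
    have htbar_le : ∀ e, tbar e ≤ t e := fun e => by
      have hpow : 0 ≤ (fhat e / fbar e) ^ (1 / μ) :=
        Real.rpow_nonneg (div_nonneg (hf0 e) (hfbar e).le) _
      simp only [ht, hτ]
      exact le_mul_of_one_le_right (htbar e).le (by nlinarith)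
    have hmodel : (1 / A) * ∑ k ∈ range N, α (k + 1) *
        (Φ (yv (k + 1)) + ∑ e, gv (k + 1) e * (t e - yv (k + 1) e)) ≤
          -∑ e, fhat e * t e := by
      have hzero : (1 / A) * ∑ k ∈ range N, α (k + 1) *
          (Φ (yv (k + 1)) + ∑ e, gv (k + 1) e * (0 - yv (k + 1) e)) ≤ 0 :=
        weighted_average_le hA hApos (fun k h => (hα' k h).le)
          fun k h => (hgsub _ (hk k h).1 (hk k h).2 0).trans hΦ0.le
      have hlin : -∑ e, fhat e * t e =
          (1 / A) * ∑ k ∈ range N, α (k + 1) * ∑ e, gv (k + 1) e * t e := by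
        simp only [hfhat, neg_mul, sum_neg_distrib, neg_neg, mul_sum, sum_mul]
        rw [sum_comm]
        exact sum_congr rfl fun k _ => sum_congr rfl fun e _ => by ring
      have hsplit : ∀ k, α (k + 1) *
          (Φ (yv (k + 1)) + ∑ e, gv (k + 1) e * (t e - yv (k + 1) e)) =
          α (k + 1) * (Φ (yv (k + 1)) + ∑ e, gv (k + 1) e * (0 - yv (k + 1) e)) +
            α (k + 1) * ∑ e, gv (k + 1) e * t e := fun k => by
        simp only [mul_sub, sum_sub_distrib, mul_zero, sum_const_zero]
        ring
      simp only [hsplit, sum_add_distrib]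
      rw [mul_add, hlin]
      linarith
    have hfenchel : ∑ e, σs e (t e) + Ψ fhat = ∑ e, fhat e * t e := by
      rw [hΨ, ← sum_add_distrib]
      refine sum_congr rfl fun e _ => ?_
      simp only [ht, hσs, hσ, hτ]
      exact beckmann_conjugate_travelTime (htbar e) (hfbar e) hρ hμ0 (hf0 e)
    have hreg : (∑ e, (t e - tbar e) ^ 2) / (2 * A) ≤ ε / 2 := by
      refine div_two_mul_le_of_iterations hApos hM hε hAlb ?_ hNR
      rw [hRt, Real.sq_sqrt, mul_sum]
      · refine sum_le_sum fun e _ => ?_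
        simp only [ht, hτ]
        exact sq_travelTime_sub_le (hfbar e) hμ0 (hf0 e) (hfhatD e)
      · exact mul_nonneg (sq_nonneg _) (sum_nonneg fun e _ => mul_nonneg
          (div_nonneg (sq_nonneg _) (Real.rpow_nonneg (hfbar e).le _)) (Real.rpow_nonneg hD _))
    linarith [hUMST t htbar_le]
end
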